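/- arXiv:2007.02636 — 2 statements merged into one kernel-verified Lean document; each statement's English description precedes it below -/
import Mathlib

section
/- Let G be a finite group, H a subnormal subgroup of G, F a perfect splitting field of characteristic 2, and U a self-dual irreducible FH-module. Then there is exactly one self-dual irreducible FG-module V such that U occurs with odd multiplicity in V↓_H. -/
open Module

section Defs
variable {F : Type} [Field F] {G : Type} [Group G]
variable {V W : Type} [AddCommGroup V] [Module F V] [AddCommGroup W] [Module F W]

def IsSubrep (ρ : Representation F G V) (U : Submodule F V) : Prop :=
  ∀ (g : G), ∀ v ∈ U, ρ g v ∈ U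

def IsIrred (ρ : Representation F G V) : Prop :=
  Nontrivial V ∧ ∀ U : Submodule F V, IsSubrep ρ U → U = ⊥ ∨ U = ⊤

def RepIso (ρ : Representation F G V) (σ : Representation F G W) : Prop :=
  ∃ e : V ≃ₗ[F] W, ∀ (g : G) (v : V), e (ρ g v) = σ g (e v)

def IsSelfDual (ρ : Representation F G V) : Prop :=
  RepIso ρ ρ.dual

def IsTrivialRep (ρ : Representation F G V) : Prop := ∀ (g : G) (v : V), ρ g v = v

def EquivHom (σ : Representation F G W) (ρ : Representation F G V) :
    Submodule F (W →ₗ[F] V) where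
  carrier := {f | ∀ (g : G) (w : W), f (σ g w) = ρ g (f w)}
  add_mem' := by
    intro f f' hf hf' g w
    simp [LinearMap.add_apply, hf g w, hf' g w]
  zero_mem' := by intro g w; simp
  smul_mem' := by
    intro c f hf g w
    simp [LinearMap.smul_apply, hf g w]

noncomputable def repMult (σ : Representation F G W) (ρ : Representation F G V) : ℕ :=
  Module.finrank F (EquivHom σ ρ)

def BilinInvariant (ρ : Representation F G V) (B : V →ₗ[F] V →ₗ[F] F) : Prop :=
  ∀ (g : G) (v w : V), B (ρ g v) (ρ g w) = B v w

def Nondeg (B : V →ₗ[F] V →ₗ[F] F) : Prop := ∀ v : V, (∀ w : V, B v w = 0) → v = 0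

def IsAltForm (B : V →ₗ[F] V →ₗ[F] F) : Prop := ∀ v : V, B v v = 0

def PolarizesTo (Q : V → F) (B : V →ₗ[F] V →ₗ[F] F) : Prop :=
  (∀ (a : F) (v : V), Q (a • v) = a ^ 2 * Q v) ∧
    ∀ v w : V, Q (v + w) = Q v + B v w + Q w

def QuadInvariant (ρ : Representation F G V) (Q : V → F) : Prop :=
  ∀ (g : G) (v : V), Q (ρ g v) = Q v

def HasQuadType (ρ : Representation F G V) : Prop :=
  ∃ (Q : V → F) (B : V →ₗ[F] V →ₗ[F] F),
    PolarizesTo Q B ∧ QuadInvariant ρ Q ∧ Nondeg B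

def IsSplitting (F G : Type) [Field F] [Group G] : Prop :=
  ∀ (V : Type) [AddCommGroup V] [Module F V] (ρ : Representation F G V),
    FiniteDimensional F V → IsIrred ρ →
      ∀ f ∈ EquivHom ρ ρ, ∃ c : F, f = c • (LinearMap.id : V →ₗ[F] V)

structure RepOn (F G : Type) [Field F] [Group G] where
  carrier : Type
  [ag : AddCommGroup carrier]
  [md : Module F carrier]
  rep : Representation F G carrier

attribute [instance] RepOn.ag RepOn.md

end Defs


/-- H is a subnormal subgroup of G. -/
def IsSubnormalIn {G : Type} [Group G] (H : Subgroup G) : Prop :=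
  ∃ (n : ℕ) (c : ℕ → Subgroup G), c 0 = H ∧ c n = ⊤ ∧
    ∀ i < n, c i ≤ c (i + 1) ∧ ∀ x ∈ c (i + 1), ∀ a ∈ c i, x * a * x⁻¹ ∈ c i

section Basic

variable {F : Type} [Field F] {G : Type} [Group G]
variable {V W X : Type} [AddCommGroup V] [Module F V] [AddCommGroup W] [Module F W]
  [AddCommGroup X] [Module F X]

/-- The representation on an invariant subspace. -/
def subRep (ρ : Representation F G V) (p : Submodule F V) (hp : IsSubrep ρ p) :
    Representation F G p where
  toFun g := (ρ g).restrict (hp g)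
  map_one' := by ext; simp
  map_mul' g h := by ext; simp

@[simp]
lemma coe_subRep_apply (ρ : Representation F G V) (p : Submodule F V) (hp : IsSubrep ρ p)
    (g : G) (v : p) : (subRep ρ p hp g v : V) = ρ g v := rfl

lemma rep_inv_apply_self (ρ : Representation F G V) (g : G) (v : V) : ρ g⁻¹ (ρ g v) = v := by
  rw [← Module.End.mul_apply, ← map_mul]; simp

lemma rep_apply_inv_self (ρ : Representation F G V) (g : G) (v : V) : ρ g (ρ g⁻¹ v) = v := by
  rw [← Module.End.mul_apply, ← map_mul]; simp

lemma isSubrep_ker {σ : Representation F G W} {ρ : Representation F G V} {f : W →ₗ[F] V}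
    (hf : f ∈ EquivHom σ ρ) : IsSubrep σ (LinearMap.ker f) := by
  intro g v hv
  rw [LinearMap.mem_ker] at *
  rw [hf g v, hv, map_zero]

lemma isSubrep_range {σ : Representation F G W} {ρ : Representation F G V} {f : W →ₗ[F] V}
    (hf : f ∈ EquivHom σ ρ) : IsSubrep ρ (LinearMap.range f) := by
  rintro g _ ⟨v, rfl⟩
  exact ⟨σ g v, hf g v⟩

lemma IsSubrep.sup {ρ : Representation F G V} {p q : Submodule F V} (hp : IsSubrep ρ p)
    (hq : IsSubrep ρ q) : IsSubrep ρ (p ⊔ q) := by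
  intro g v hv
  obtain ⟨y, hy, z, hz, rfl⟩ := Submodule.mem_sup.1 hv
  rw [map_add]
  exact Submodule.add_mem_sup (hp g y hy) (hq g z hz)

lemma IsSubrep.map_subtype {ρ : Representation F G V} {p : Submodule F V} (hp : IsSubrep ρ p)
    {r : Submodule F p} (hr : IsSubrep (subRep ρ p hp) r) : IsSubrep ρ (r.map p.subtype) := by
  rintro g _ ⟨v, hv, rfl⟩
  exact ⟨_, hr g v hv, rfl⟩

lemma IsSubrep.comap_subtype {ρ : Representation F G V} {p r : Submodule F V}
    (hp : IsSubrep ρ p) (hr : IsSubrep ρ r) : IsSubrep (subRep ρ p hp) (r.comap p.subtype) :=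
  fun g v hv => hr g v hv

lemma IsIrred.injective {σ : Representation F G W} {ρ : Representation F G V} (hσ : IsIrred σ)
    {f : W →ₗ[F] V} (hf : f ∈ EquivHom σ ρ) (h0 : f ≠ 0) : Function.Injective f := by
  rcases hσ.2 _ (isSubrep_ker hf) with h | h
  · exact LinearMap.ker_eq_bot.1 h
  · exact absurd (LinearMap.ker_eq_top.1 h) h0

lemma IsIrred.surjective {σ : Representation F G W} {ρ : Representation F G V} (hρ : IsIrred ρ)
    {f : W →ₗ[F] V} (hf : f ∈ EquivHom σ ρ) (h0 : f ≠ 0) : Function.Surjective f := by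
  rcases hρ.2 _ (isSubrep_range hf) with h | h
  · exact absurd (LinearMap.range_eq_bot.1 h) h0
  · exact LinearMap.range_eq_top.1 h

lemma repIso_of_bijective {σ : Representation F G W} {ρ : Representation F G V}
    {f : W →ₗ[F] V} (hf : f ∈ EquivHom σ ρ) (hb : Function.Bijective f) : RepIso σ ρ :=
  ⟨LinearEquiv.ofBijective f hb, hf⟩

lemma IsIrred.repIso {σ : Representation F G W} {ρ : Representation F G V} (hσ : IsIrred σ)
    (hρ : IsIrred ρ) {f : W →ₗ[F] V} (hf : f ∈ EquivHom σ ρ) (h0 : f ≠ 0) : RepIso σ ρ :=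
  repIso_of_bijective hf ⟨hσ.injective hf h0, hρ.surjective hf h0⟩

lemma RepIso.symm {σ : Representation F G W} {ρ : Representation F G V} (h : RepIso σ ρ) :
    RepIso ρ σ := by
  obtain ⟨e, he⟩ := h
  refine ⟨e.symm, fun g v => e.injective ?_⟩
  simp [he]

lemma RepIso.trans {σ : Representation F G W} {ρ : Representation F G V}
    {τ : Representation F G X} (h : RepIso σ ρ) (h' : RepIso ρ τ) : RepIso σ τ := by
  obtain ⟨e, he⟩ := h
  obtain ⟨e', he'⟩ := h'
  exact ⟨e.trans e', fun g v => by simp [he, he']⟩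

lemma RepIso.comp {A : Type} [Group A] {σ : Representation F G W} {ρ : Representation F G V}
    (h : RepIso σ ρ) (ι : A →* G) : RepIso (σ.comp ι) (ρ.comp ι) := by
  obtain ⟨e, he⟩ := h
  exact ⟨e, fun g v => he (ι g) v⟩

lemma dual_rep_apply (ρ : Representation F G V) (g : G) (x : Dual F V) (v : V) :
    ρ.dual g x v = x (ρ g⁻¹ v) := rfl

lemma repIso_dual_dual [FiniteDimensional F V] (ρ : Representation F G V) :
    RepIso ρ.dual.dual ρ := by
  refine RepIso.symm ⟨Module.evalEquiv F V, fun g v => LinearMap.ext fun x => ?_⟩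
  change x (ρ g v) = x (ρ g⁻¹⁻¹ v)
  rw [inv_inv]

lemma IsIrred.dual [FiniteDimensional F V] {ρ : Representation F G V} (hρ : IsIrred ρ) :
    IsIrred ρ.dual := by
  have := hρ.1
  refine ⟨inferInstance, fun p hp => ?_⟩
  have hs : IsSubrep ρ p.dualCoannihilator := by
    intro g v hv
    rw [Submodule.mem_dualCoannihilator] at *
    intro x hx
    have := hv _ (hp g⁻¹ x hx)
    rwa [dual_rep_apply, inv_inv] at this
  have key : p.dualCoannihilator.dualAnnihilator = p :=
    Subspace.dualCoannihilator_dualAnnihilator_eq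
  rcases hρ.2 _ hs with h | h
  · right; rw [← key, h]; simp
  · left; rw [← key, h]; simp

lemma repMult_congr_right {Y : Type} [AddCommGroup Y] [Module F Y]
    (σ : Representation F G W) {ρ : Representation F G V} {τ : Representation F G Y}
    (h : RepIso ρ τ) : repMult σ ρ = repMult σ τ := by
  obtain ⟨e, he⟩ := h
  have he' : ∀ g v, e.symm (τ g v) = ρ g (e.symm v) := fun g v => e.injective (by simp [he])
  refine LinearEquiv.finrank_eq
    { toFun := fun f => ⟨e.toLinearMap ∘ₗ f.1, fun g w => by simp [f.2 g w, he]⟩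
      invFun := fun f => ⟨e.symm.toLinearMap ∘ₗ f.1, fun g w => by simp [f.2 g w, he']⟩
      map_add' := fun f f' => by ext; simp
      map_smul' := fun c f => by ext; simp
      left_inv := fun f => by ext; simp
      right_inv := fun f => by ext; simp }

lemma repMult_congr_left {Y : Type} [AddCommGroup Y] [Module F Y]
    {σ : Representation F G W} {τ : Representation F G Y} (h : RepIso σ τ)
    (ρ : Representation F G V) : repMult σ ρ = repMult τ ρ := by
  obtain ⟨e, he⟩ := h
  have he' : ∀ g v, e.symm (τ g v) = σ g (e.symm v) := fun g v => e.injective (by simp [he])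
  refine LinearEquiv.finrank_eq
    { toFun := fun f => ⟨f.1 ∘ₗ e.symm.toLinearMap, fun g w => by simp [he', f.2 g]⟩
      invFun := fun f => ⟨f.1 ∘ₗ e.toLinearMap, fun g w => by simp [he, f.2 g]⟩
      map_add' := fun f f' => by ext; simp
      map_smul' := fun c f => by ext; simp
      left_inv := fun f => by ext; simp
      right_inv := fun f => by ext; simp }

lemma repMult_dual_right (σ : Representation F G W) (ρ : Representation F G V) :
    repMult σ ρ.dual = repMult ρ σ.dual := by
  have key : ∀ {W V : Type} [AddCommGroup V] [Module F V] [AddCommGroup W] [Module F W]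
      (σ : Representation F G W) (ρ : Representation F G V) (f : W →ₗ[F] Dual F V),
      f ∈ EquivHom σ ρ.dual → f.flip ∈ EquivHom ρ σ.dual := by
    intro W V _ _ _ _ σ ρ f hf g v
    ext w
    rw [dual_rep_apply, LinearMap.flip_apply, LinearMap.flip_apply, hf g⁻¹ w, dual_rep_apply,
      inv_inv]
  refine LinearEquiv.finrank_eq
    { toFun := fun f => ⟨f.1.flip, key _ _ _ f.2⟩
      invFun := fun f => ⟨f.1.flip, key _ _ _ f.2⟩
      map_add' := fun f f' => by ext; simp
      map_smul' := fun c f => by ext; simp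
      left_inv := fun f => by ext; simp
      right_inv := fun f => by ext; simp }

lemma repMult_dual_dual [FiniteDimensional F W]
    (σ : Representation F G W) (ρ : Representation F G V) :
    repMult σ.dual ρ.dual = repMult ρ σ := by
  rw [repMult_dual_right, repMult_congr_right _ (repIso_dual_dual σ)]

lemma repMult_pos [FiniteDimensional F W] [FiniteDimensional F V]
    {σ : Representation F G W} {ρ : Representation F G V}
    {f : W →ₗ[F] V} (hf : f ∈ EquivHom σ ρ) (h0 : f ≠ 0) : 0 < repMult σ ρ := by
  have : Nontrivial (EquivHom σ ρ) :=
    ⟨⟨⟨f, hf⟩, 0, fun h => h0 (congrArg Subtype.val h)⟩⟩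
  exact Module.finrank_pos

lemma exists_ne_zero_of_repMult_ne_zero {σ : Representation F G W} {ρ : Representation F G V}
    (h : repMult σ ρ ≠ 0) : ∃ f ∈ EquivHom σ ρ, f ≠ 0 := by
  have := Module.nontrivial_of_finrank_pos (Nat.pos_of_ne_zero h)
  obtain ⟨f, hf⟩ := exists_ne (0 : EquivHom σ ρ)
  exact ⟨f.1, f.2, fun h => hf (Subtype.ext h)⟩

lemma IsIrred.repIso_of_repMult_ne_zero {σ : Representation F G W} {ρ : Representation F G V}
    (hσ : IsIrred σ) (hρ : IsIrred ρ) (h : repMult σ ρ ≠ 0) : RepIso σ ρ := by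
  obtain ⟨f, hf, h0⟩ := exists_ne_zero_of_repMult_ne_zero h
  exact hσ.repIso hρ hf h0

lemma IsIrred.repMult_comm {σ : Representation F G W} {ρ : Representation F G V}
    (hσ : IsIrred σ) (hρ : IsIrred ρ) : repMult σ ρ = repMult ρ σ := by
  by_cases h : RepIso σ ρ
  · rw [repMult_congr_left h, repMult_congr_right ρ h]
  · have h1 : repMult σ ρ = 0 := by
      by_contra h0
      exact h (hσ.repIso_of_repMult_ne_zero hρ h0)
    have h2 : repMult ρ σ = 0 := by
      by_contra h0
      exact h (hρ.repIso_of_repMult_ne_zero hσ h0).symm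
    rw [h1, h2]

lemma IsIrred.repMult_self [FiniteDimensional F W] (hs : IsSplitting F G)
    {σ : Representation F G W} (hσ : IsIrred σ) : repMult σ σ = 1 := by
  have := hσ.1
  have hid : (LinearMap.id : W →ₗ[F] W) ∈ EquivHom σ σ := fun g w => rfl
  refine finrank_eq_one (⟨LinearMap.id, hid⟩ : EquivHom σ σ) ?_ ?_
  · intro h
    have h' : (LinearMap.id : W →ₗ[F] W) = 0 := congrArg Subtype.val h
    obtain ⟨w, hw⟩ := exists_ne (0 : W)
    exact hw (by simpa using LinearMap.congr_fun h' w)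
  · rintro ⟨f, hf⟩
    obtain ⟨c, hc⟩ := hs W σ inferInstance hσ f hf
    exact ⟨c, Subtype.ext hc.symm⟩

lemma exists_irred_subrep [FiniteDimensional F V] [Nontrivial V] (ρ : Representation F G V) :
    ∃ (p : Submodule F V) (hp : IsSubrep ρ p), IsIrred (subRep ρ p hp) := by
  obtain ⟨p, ⟨hp, hne⟩, hmin⟩ := WellFounded.has_min (wellFounded_lt (α := Submodule F V))
    {p | IsSubrep ρ p ∧ p ≠ ⊥} ⟨⊤, fun _ _ _ => trivial, top_ne_bot⟩
  refine ⟨p, hp, (Submodule.nontrivial_iff_ne_bot).2 hne, fun r hr => ?_⟩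
  by_cases h : r.map p.subtype = ⊥
  · left
    apply Submodule.map_injective_of_injective p.injective_subtype
    rw [h, Submodule.map_bot]
  · right
    have hle : r.map p.subtype ≤ p := Submodule.map_subtype_le p r
    have heq : r.map p.subtype = p := by
      by_contra h'
      exact hmin _ ⟨hp.map_subtype hr, h⟩ (lt_of_le_of_ne hle h')
    apply Submodule.map_injective_of_injective p.injective_subtype
    rw [heq, Submodule.map_subtype_top]

end Basic

section Semisimple

variable {F : Type} [Field F] {A B : Type} [Group A] [Group B]
variable {U V W : Type} [AddCommGroup V] [Module F V] [AddCommGroup W] [Module F W]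
  [AddCommGroup U] [Module F U]

/-- Every invariant subspace has an invariant complement. -/
def IsSemisimpleRep (ρ : Representation F B V) : Prop :=
  ∀ p, IsSubrep ρ p → ∃ q, IsSubrep ρ q ∧ IsCompl p q

lemma IsSemisimpleRep.subRep {ρ : Representation F B V} (h : IsSemisimpleRep ρ)
    (p : Submodule F V) (hp : IsSubrep ρ p) : IsSemisimpleRep (subRep ρ p hp) := by
  intro r hr
  obtain ⟨q, hq, hc⟩ := h _ (hp.map_subtype hr)
  refine ⟨q.comap p.subtype, hp.comap_subtype hq, ?_⟩
  rw [isCompl_iff, disjoint_iff, codisjoint_iff] at hc ⊢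
  constructor
  · rw [eq_bot_iff]
    rintro x ⟨hx1, hx2⟩
    have : (x : V) ∈ r.map p.subtype ⊓ q := ⟨⟨x, hx1, rfl⟩, hx2⟩
    rw [hc.1] at this
    simpa using this
  · rw [eq_top_iff]
    rintro x -
    have : (x : V) ∈ r.map p.subtype ⊔ q := by rw [hc.2]; trivial
    obtain ⟨_, ⟨y, hy, rfl⟩, z, hz, hyz⟩ := Submodule.mem_sup.1 this
    have hz' : z = ((x - y : p) : V) := by
      rw [Submodule.coe_sub, ← hyz]; simp
    refine Submodule.mem_sup.2 ⟨y, hy, x - y, ?_, by simp⟩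
    rw [Submodule.mem_comap]
    simpa [hz'] using hz

section DirectSum

variable {V₁ V₂ : Type} [AddCommGroup V₁] [Module F V₁] [AddCommGroup V₂] [Module F V₂]
  [FiniteDimensional F U] [FiniteDimensional F V₁] [FiniteDimensional F V₂]

lemma repMult_prod_right (σ : Representation F A U) {ρ : Representation F A V}
    {ρ₁ : Representation F A V₁} {ρ₂ : Representation F A V₂} (e : (V₁ × V₂) ≃ₗ[F] V)
    (he : ∀ g x, e (ρ₁ g x.1, ρ₂ g x.2) = ρ g (e x)) :
    repMult σ ρ = repMult σ ρ₁ + repMult σ ρ₂ := by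
  have he' : ∀ g v, e.symm (ρ g v) = (ρ₁ g (e.symm v).1, ρ₂ g (e.symm v).2) :=
    fun g v => e.injective (by simp [he])
  unfold repMult
  rw [← Module.finrank_prod]
  symm
  let φ : (EquivHom σ ρ₁ × EquivHom σ ρ₂) ≃ₗ[F] EquivHom σ ρ :=
    { toFun := fun f => ⟨e.toLinearMap ∘ₗ f.1.1.prod f.2.1, fun g w => by
        simp [f.1.2 g w, f.2.2 g w, ← he]⟩
      invFun := fun f => (⟨LinearMap.fst F V₁ V₂ ∘ₗ e.symm.toLinearMap ∘ₗ f.1, fun g w => by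
        simp [f.2 g w, he']⟩, ⟨LinearMap.snd F V₁ V₂ ∘ₗ e.symm.toLinearMap ∘ₗ f.1, fun g w => by
        simp [f.2 g w, he']⟩)
      map_add' := fun f f' => Subtype.ext (LinearMap.ext fun w => by
        simp [← map_add])
      map_smul' := fun c f => Subtype.ext (LinearMap.ext fun w =>
        map_smul e c (f.1.1 w, f.2.1 w))
      left_inv := fun f => Prod.ext (Subtype.ext (LinearMap.ext fun w => by simp))
        (Subtype.ext (LinearMap.ext fun w => by simp))
      right_inv := fun f => Subtype.ext (LinearMap.ext fun w => by simp) }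
  exact φ.finrank_eq

lemma repMult_prod_left (σ : Representation F A U) {ρ : Representation F A V}
    {ρ₁ : Representation F A V₁} {ρ₂ : Representation F A V₂} (e : (V₁ × V₂) ≃ₗ[F] V)
    (he : ∀ g x, e (ρ₁ g x.1, ρ₂ g x.2) = ρ g (e x)) :
    repMult ρ σ = repMult ρ₁ σ + repMult ρ₂ σ := by
  have he' : ∀ g v, e.symm (ρ g v) = (ρ₁ g (e.symm v).1, ρ₂ g (e.symm v).2) :=
    fun g v => e.injective (by simp [he])
  have h₁ : ∀ g x, e (ρ₁ g x, 0) = ρ g (e (x, 0)) := fun g x => by simp [← he]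
  have h₂ : ∀ g x, e (0, ρ₂ g x) = ρ g (e (0, x)) := fun g x => by simp [← he]
  unfold repMult
  rw [← Module.finrank_prod]
  symm
  let φ : (EquivHom ρ₁ σ × EquivHom ρ₂ σ) ≃ₗ[F] EquivHom ρ σ :=
    { toFun := fun f => ⟨f.1.1.coprod f.2.1 ∘ₗ e.symm.toLinearMap, fun g w => by
        simp [he', f.1.2 g, f.2.2 g]⟩
      invFun := fun f => (⟨f.1 ∘ₗ e.toLinearMap ∘ₗ LinearMap.inl F V₁ V₂, fun g w => by
        simp [h₁, f.2 g]⟩, ⟨f.1 ∘ₗ e.toLinearMap ∘ₗ LinearMap.inr F V₁ V₂, fun g w => by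
        simp [h₂, f.2 g]⟩)
      map_add' := fun f f' => Subtype.ext (LinearMap.ext fun w => by
        simp only [Prod.fst_add, Prod.snd_add, Submodule.coe_add, LinearMap.comp_apply,
          LinearMap.coprod_apply, LinearMap.add_apply]
        abel)
      map_smul' := fun c f => Subtype.ext (LinearMap.ext fun w => by simp)
      left_inv := fun f => Prod.ext (Subtype.ext (LinearMap.ext fun w => by simp))
        (Subtype.ext (LinearMap.ext fun w => by simp))
      right_inv := fun f => Subtype.ext (LinearMap.ext fun w => by
        simp [← map_add]) }
  exact φ.finrank_eq

end DirectSum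

lemma repMult_add_right [FiniteDimensional F U] [FiniteDimensional F V] (ι : A →* B)
    (σ : Representation F A U) (ρ : Representation F B V)
    {p q : Submodule F V} (hp : IsSubrep ρ p) (hq : IsSubrep ρ q) (h : IsCompl p q) :
    repMult σ (ρ.comp ι) =
      repMult σ ((subRep ρ p hp).comp ι) + repMult σ ((subRep ρ q hq).comp ι) :=
  repMult_prod_right σ (p.prodEquivOfIsCompl q h) fun g x => by simp

lemma repMult_add_left [FiniteDimensional F U] [FiniteDimensional F V] (ι : A →* B)
    (σ : Representation F A U) (ρ : Representation F B V)
    {p q : Submodule F V} (hp : IsSubrep ρ p) (hq : IsSubrep ρ q) (h : IsCompl p q) :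
    repMult (ρ.comp ι) σ =
      repMult ((subRep ρ p hp).comp ι) σ + repMult ((subRep ρ q hq).comp ι) σ :=
  repMult_prod_left σ (p.prodEquivOfIsCompl q h) fun g x => by simp

/-- A semisimple representation of positive dimension splits off an irreducible summand. -/
lemma IsSemisimpleRep.exists_irred_isCompl [FiniteDimensional F V] [Nontrivial V]
    {ρ : Representation F B V} (h : IsSemisimpleRep ρ) :
    ∃ (p q : Submodule F V) (hp : IsSubrep ρ p) (hq : IsSubrep ρ q), IsCompl p q ∧
      IsIrred (_root_.subRep ρ p hp) ∧ IsSemisimpleRep (_root_.subRep ρ q hq) ∧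
      Module.finrank F q < Module.finrank F V := by
  obtain ⟨p, hp, hirr⟩ := exists_irred_subrep ρ
  obtain ⟨q, hq, hc⟩ := h p hp
  refine ⟨p, q, hp, hq, hc, hirr, h.subRep q hq, ?_⟩
  have := hirr.1
  have h1 : 0 < Module.finrank F p := Module.finrank_pos
  have h2 := Submodule.finrank_add_eq_of_isCompl hc
  omega

lemma repMult_eq_zero_of_subsingleton_right [Subsingleton V] (σ : Representation F A U)
    (ρ : Representation F A V) : repMult σ ρ = 0 := by
  have : Subsingleton (EquivHom σ ρ) :=
    ⟨fun f g => Subtype.ext (LinearMap.ext fun w => Subsingleton.elim _ _)⟩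
  exact Module.finrank_zero_of_subsingleton

lemma repMult_eq_zero_of_subsingleton_left [Subsingleton V] (σ : Representation F A U)
    (ρ : Representation F A V) : repMult ρ σ = 0 := by
  have : Subsingleton (EquivHom ρ σ) :=
    ⟨fun f g => Subtype.ext (LinearMap.ext fun w => by
      rw [Subsingleton.elim w 0, map_zero, map_zero])⟩
  exact Module.finrank_zero_of_subsingleton

/-- Symmetry of Hom-dimensions extends from irreducible to semisimple representations. -/
lemma repMult_comm_of_isSemisimpleRep [FiniteDimensional F U] (ι : A →* B)
    (σ : Representation F A U)
    (hσ : ∀ (S : Type) [AddCommGroup S] [Module F S] (τ : Representation F B S),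
      FiniteDimensional F S → IsIrred τ → repMult σ (τ.comp ι) = repMult (τ.comp ι) σ)
    {V : Type} [AddCommGroup V] [Module F V] [FiniteDimensional F V]
    (ρ : Representation F B V) (hρ : IsSemisimpleRep ρ) :
    repMult σ (ρ.comp ι) = repMult (ρ.comp ι) σ := by
  induction hn : Module.finrank F V using Nat.strong_induction_on generalizing V with
  | _ n ih =>
    rcases subsingleton_or_nontrivial V with hV | hV
    · rw [repMult_eq_zero_of_subsingleton_right, repMult_eq_zero_of_subsingleton_left]
    · obtain ⟨p, q, hp, hq, hc, hirr, hss, hlt⟩ := hρ.exists_irred_isCompl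
      rw [repMult_add_right ι σ ρ hp hq hc, repMult_add_left ι σ ρ hp hq hc,
        hσ p _ inferInstance hirr, ih _ (hn ▸ hlt) _ hss rfl]

lemma IsIrred.repMult_comm_of_isSemisimpleRep [FiniteDimensional F U]
    {σ : Representation F A U} (hσ : IsIrred σ) [FiniteDimensional F V]
    {ρ : Representation F A V} (hρ : IsSemisimpleRep ρ) : repMult σ ρ = repMult ρ σ :=
  _root_.repMult_comm_of_isSemisimpleRep (MonoidHom.id A) σ
    (fun _ _ _ _ _ hτ => hσ.repMult_comm hτ) ρ hρ

end Semisimple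

section Parity

variable {F : Type} [Field F] {A B : Type} [Group A] [Group B]
variable {U V W : Type} [AddCommGroup U] [Module F U] [AddCommGroup V] [Module F V]
  [AddCommGroup W] [Module F W]

lemma repMult_add_right_self [FiniteDimensional F U] [FiniteDimensional F V]
    (σ : Representation F B U) (ρ : Representation F B V)
    {p q : Submodule F V} (hp : IsSubrep ρ p) (hq : IsSubrep ρ q) (h : IsCompl p q) :
    repMult σ ρ = repMult σ (subRep ρ p hp) + repMult σ (subRep ρ q hq) :=
  repMult_add_right (MonoidHom.id B) σ ρ hp hq h

lemma dual_comp (ρ : Representation F B V) (ι : A →* B) :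
    ρ.dual.comp ι = Representation.dual (ρ.comp ι) := by
  ext g x v
  change x (ρ ((ι g)⁻¹) v) = x (ρ (ι g⁻¹) v)
  rw [map_inv ι]

lemma IsIrred.repMult_dual_dual [FiniteDimensional F U] {σ : Representation F B U}
    {τ : Representation F B V} (hσ : IsIrred σ) (hτ : IsIrred τ) :
    repMult σ.dual τ.dual = repMult σ τ := by
  rw [_root_.repMult_dual_dual, hτ.repMult_comm hσ]

lemma IsSemisimpleRep.repMult_dual [FiniteDimensional F U] [FiniteDimensional F V]
    {σ : Representation F A U} {ρ : Representation F A V} (hρ : IsSemisimpleRep ρ)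
    (hσ : IsIrred σ) (hsd : IsSelfDual ρ) : repMult σ.dual ρ = repMult σ ρ := by
  rw [hσ.dual.repMult_comm_of_isSemisimpleRep hρ, repMult_dual_right,
    ← repMult_congr_right σ hsd]

/-- If `ω` is the only self-dual irreducible representation of `B` in which `σ` has odd
multiplicity, then in every semisimple representation with duality-invariant multiplicities the
multiplicities of `σ` and `ω` have the same parity. -/
lemma even_repMult_add_repMult [FiniteDimensional F U] [FiniteDimensional F W] (ι : A →* B)
    (σ : Representation F A U) (hB : IsSplitting F B)
    (ω : Representation F B W) (hω : IsIrred ω) (hωd : IsSelfDual ω)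
    (hodd : Odd (repMult σ (ω.comp ι)))
    (huniq : ∀ (S : Type) [AddCommGroup S] [Module F S] (τ : Representation F B S),
      FiniteDimensional F S → IsIrred τ → IsSelfDual τ → Odd (repMult σ (τ.comp ι)) →
      RepIso τ ω)
    (hdual : ∀ (S : Type) [AddCommGroup S] [Module F S] (τ : Representation F B S),
      FiniteDimensional F S → IsIrred τ → repMult σ (τ.dual.comp ι) = repMult σ (τ.comp ι))
    {V : Type} [AddCommGroup V] [Module F V] [FiniteDimensional F V]
    (ρ : Representation F B V) (hρ : IsSemisimpleRep ρ)
    (hsymm : ∀ (S : Type) [AddCommGroup S] [Module F S] (τ : Representation F B S),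
      FiniteDimensional F S → IsIrred τ → repMult τ.dual ρ = repMult τ ρ) :
    Even (repMult σ (ρ.comp ι) + repMult ω ρ) := by
  induction hn : Module.finrank F V using Nat.strong_induction_on generalizing V with
  | _ n ih =>
  rcases subsingleton_or_nontrivial V with hV | hV
  · simp [repMult_eq_zero_of_subsingleton_right]
  obtain ⟨p, q, hp, hq, hc, hirr, hss, hlt⟩ := hρ.exists_irred_isCompl
  set τ := subRep ρ p hp with hτ
  set π := subRep ρ q hq with hπ
  have hadd : ∀ (S : Type) [AddCommGroup S] [Module F S] (κ : Representation F B S),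
      FiniteDimensional F S → repMult κ ρ = repMult κ τ + repMult κ π :=
    fun S _ _ κ _ => repMult_add_right_self κ ρ hp hq hc
  have hσadd : repMult σ (ρ.comp ι) = repMult σ (τ.comp ι) + repMult σ (π.comp ι) :=
    repMult_add_right ι σ ρ hp hq hc
  by_cases hsd : IsSelfDual τ
  · have hτω : Even (repMult σ (τ.comp ι) + repMult ω τ) := by
      by_cases hiso : RepIso τ ω
      · rw [← repMult_congr_left hiso, hirr.repMult_self hB,
          repMult_congr_right σ (hiso.comp ι)]
        exact hodd.add_one
      · have h0 : repMult ω τ = 0 := by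
          by_contra h0
          exact hiso (hω.repIso_of_repMult_ne_zero hirr h0).symm
        rw [h0, add_zero, ← Nat.not_odd_iff_even]
        exact fun h => hiso (huniq p τ inferInstance hirr hsd h)
    have hπω := ih _ (hn ▸ hlt) π hss (fun S _ _ κ _ hκ => by
      have h1 := hsymm S κ inferInstance hκ
      rw [hadd S κ inferInstance, hadd _ κ.dual inferInstance,
        repMult_congr_right κ.dual hsd, hκ.repMult_dual_dual hirr] at h1
      omega) rfl
    rw [hσadd, hadd W ω inferInstance]
    rw [Nat.even_iff] at *
    omega
  · have hne : repMult τ.dual τ = 0 := by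
      by_contra h0
      exact hsd (hirr.dual.repIso_of_repMult_ne_zero hirr h0).symm
    have hpos : repMult τ.dual π ≠ 0 := by
      have h1 := hsymm p τ inferInstance hirr
      have h2 := hirr.repMult_self hB
      rw [hadd p τ inferInstance, hadd _ τ.dual inferInstance] at h1
      omega
    obtain ⟨f, hf, hf0⟩ := exists_ne_zero_of_repMult_ne_zero hpos
    have hp' := isSubrep_range hf
    obtain ⟨q', hq', hc'⟩ := hss _ hp'
    have hiso : RepIso τ.dual (subRep π _ hp') :=
      repIso_of_bijective (f := f.rangeRestrict) (fun g x => Subtype.ext (hf g x))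
        ⟨fun x y h => hirr.dual.injective hf hf0 (congrArg Subtype.val h),
          f.surjective_rangeRestrict⟩
    have hlt' : Module.finrank F q' < n :=
      (Submodule.finrank_le q').trans_lt (hn ▸ hlt)
    have hadd' : ∀ (S : Type) [AddCommGroup S] [Module F S] (κ : Representation F B S),
        FiniteDimensional F S →
        repMult κ π = repMult κ τ.dual + repMult κ (subRep π q' hq') :=
      fun S _ _ κ _ => by
        rw [repMult_add_right_self κ π hp' hq' hc', repMult_congr_right κ hiso]
    have hσadd' : repMult σ (π.comp ι) =
        repMult σ (τ.comp ι) + repMult σ ((subRep π q' hq').comp ι) := by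
      rw [repMult_add_right ι σ π hp' hq' hc', ← repMult_congr_right σ (hiso.comp ι),
        hdual p τ inferInstance hirr]
    have hdd : ∀ (S : Type) [AddCommGroup S] [Module F S] (κ : Representation F B S),
        FiniteDimensional F S → IsIrred κ → repMult κ.dual τ = repMult κ τ.dual :=
      fun S _ _ κ _ hκ => by
        rw [← repMult_congr_right κ.dual (repIso_dual_dual τ),
          hκ.repMult_dual_dual hirr.dual]
    have hrest := ih _ hlt' (subRep π q' hq') (hss.subRep q' hq') (fun S _ _ κ _ hκ => by
      have h1 := hsymm S κ inferInstance hκ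
      rw [hadd S κ inferInstance, hadd _ κ.dual inferInstance, hadd' S κ inferInstance,
        hadd' _ κ.dual inferInstance, hdd S κ inferInstance hκ,
        hκ.repMult_dual_dual hirr] at h1
      omega) rfl
    have hω2 : repMult ω τ.dual = repMult ω τ := by
      rw [← hdd W ω inferInstance hω, ← repMult_congr_left hωd]
    rw [hσadd, hσadd', hadd W ω inferInstance, hadd' W ω inferInstance, hω2]
    rw [Nat.even_iff] at *
    omega

end Parity

section Clifford

variable {F : Type} [Field F] {A B : Type} [Group A] [Group B]
variable {U V : Type} [AddCommGroup U] [Module F U] [AddCommGroup V] [Module F V]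

/-- An invariant-under-the-group condition on vectors of an irreducible representation that holds
for a nonzero vector holds everywhere. -/
lemma IsIrred.forall_mem_of_forall_apply_mem {ρ : Representation F B V} (hρ : IsIrred ρ)
    (r : Submodule F V) {v : V} (hv : v ≠ 0) (h : ∀ g, ρ g v ∈ r) (w : V) : w ∈ r := by
  let N : Submodule F V := ⨅ g, r.comap (ρ g)
  have hN : IsSubrep ρ N := by
    intro g x hx
    simp only [N, Submodule.mem_iInf, Submodule.mem_comap] at *
    intro k
    rw [← Module.End.mul_apply, ← map_mul]
    exact hx _
  have hvN : v ∈ N := by simpa [N] using h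
  rcases hρ.2 N hN with h0 | h1
  · rw [h0] at hvN
    exact absurd (by simpa using hvN) hv
  · have hw : w ∈ N := by rw [h1]; trivial
    simp only [N, Submodule.mem_iInf, Submodule.mem_comap] at hw
    simpa using hw 1

/-- Clifford's theorem. -/
theorem IsIrred.isSemisimpleRep_comp [FiniteDimensional F V] (ι : A →* B)
    (hn : ∀ g a, ∃ a', g * ι a * g⁻¹ = ι a') {ρ : Representation F B V} (hρ : IsIrred ρ) :
    IsSemisimpleRep (ρ.comp ι) := by
  have := hρ.1
  obtain ⟨S, hS, hSirr⟩ := exists_irred_subrep (ρ.comp ι)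
  have htrans : ∀ g, IsSubrep (ρ.comp ι) (S.map (ρ g)) := by
    rintro g a _ ⟨v, hv, rfl⟩
    obtain ⟨a', ha'⟩ := hn g⁻¹ a
    refine ⟨ρ (ι a') v, hS a' v hv, ?_⟩
    change ρ g (ρ (ι a') v) = ρ (ι a) (ρ g v)
    rw [← ha', ← Module.End.mul_apply, ← Module.End.mul_apply, ← map_mul, ← map_mul]
    congr 2
    group
  have hatom : ∀ g r, IsSubrep (ρ.comp ι) r → S.map (ρ g) ≤ r ∨ Disjoint r (S.map (ρ g)) := by
    intro g r hr
    have hsub : IsSubrep (subRep (ρ.comp ι) S hS) ((r.comap (ρ g)).comap S.subtype) := by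
      intro a v hv
      obtain ⟨a', ha'⟩ := hn g a
      change ρ g (ρ (ι a) v) ∈ r
      have : ρ g (ρ (ι a) v) = ρ (ι a') (ρ g v) := by
        rw [← ha', ← Module.End.mul_apply, ← Module.End.mul_apply, ← map_mul, ← map_mul]
        congr 2
        group
      rw [this]
      exact hr a' _ hv
    rcases hSirr.2 _ hsub with h | h
    · right
      rw [Submodule.disjoint_def]
      rintro _ hx ⟨v, hv, rfl⟩
      have : (⟨v, hv⟩ : S) ∈ (r.comap (ρ g)).comap S.subtype := hx
      rw [h] at this
      have hv0 : v = 0 := congrArg Subtype.val ((Submodule.mem_bot F).1 this)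
      rw [hv0, map_zero]
    · left
      rintro _ ⟨v, hv, rfl⟩
      have : (⟨v, hv⟩ : S) ∈ (r.comap (ρ g)).comap S.subtype := by rw [h]; trivial
      exact this
  intro p hp
  obtain ⟨q, ⟨hq, hpq⟩, hmax⟩ := WellFounded.has_min (wellFounded_gt (α := Submodule F V))
    {q | IsSubrep (ρ.comp ι) q ∧ Disjoint p q}
    ⟨⊥, fun g v hv => by rw [Submodule.mem_bot] at *; rw [hv, map_zero], disjoint_bot_right⟩
  refine ⟨q, hq, hpq, ?_⟩
  have hall : ∀ g, S.map (ρ g) ≤ p ⊔ q := by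
    intro g
    rcases hatom g _ (hp.sup hq) with h | h
    · exact h
    · have hd : Disjoint p (q ⊔ S.map (ρ g)) :=
        hpq.disjoint_sup_right_of_disjoint_sup_left h
      have hnlt := hmax _ ⟨hq.sup (htrans g), hd⟩
      have heq : q = q ⊔ S.map (ρ g) := by
        by_contra hne
        exact hnlt (lt_of_le_of_ne le_sup_left hne)
      exact (le_sup_right.trans heq.ge).trans le_sup_right
  have := hSirr.1
  obtain ⟨s, hs⟩ := exists_ne (0 : S)
  rw [codisjoint_iff, eq_top_iff]
  exact fun w _ => hρ.forall_mem_of_forall_apply_mem _ (fun h => hs (Subtype.ext h))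
    (fun g => hall g ⟨s, s.2, rfl⟩) w

end Clifford

section Alternating

variable {F : Type} [Field F]

/-- A nondegenerate alternating form lives on an even-dimensional space. -/
lemma even_finrank_of_isAltForm {V : Type} [AddCommGroup V] [Module F V] [FiniteDimensional F V]
    (b : V →ₗ[F] V →ₗ[F] F) (halt : IsAltForm b) (hb : Nondeg b) :
    Even (Module.finrank F V) := by
  induction hn : Module.finrank F V using Nat.strong_induction_on generalizing V with
  | _ n ih =>
  subst hn
  rcases subsingleton_or_nontrivial V with hV | hV
  · simp [Module.finrank_zero_of_subsingleton]
  obtain ⟨v, hv⟩ := exists_ne (0 : V)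
  obtain ⟨w', hw'⟩ : ∃ w, b v w ≠ 0 := by
    by_contra! h
    exact hv (hb v h)
  obtain ⟨w, hw⟩ : ∃ w, b v w = 1 := ⟨(b v w')⁻¹ • w', by simp [hw']⟩
  have hskew : ∀ x y, b x y = - b y x := by
    intro x y
    have := halt (x + y)
    simp only [map_add, LinearMap.add_apply, halt x, halt y, zero_add, add_zero] at this
    linear_combination this
  let φ : V →ₗ[F] F × F := (b v).prod (b w)
  have hφ : Function.Surjective φ := by
    rintro ⟨a, c⟩
    refine ⟨a • w - c • v, ?_⟩
    simp [φ, hw, halt v, halt w, hskew w v]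
  let K := LinearMap.ker φ
  have hK : ∀ y : K, b v y = 0 ∧ b w y = 0 := by
    intro y
    have h : φ y = 0 := y.2
    exact ⟨congrArg Prod.fst h, congrArg Prod.snd h⟩
  have hdim : Module.finrank F K + 2 = Module.finrank F V := by
    have h1 := φ.finrank_range_add_finrank_ker
    rw [LinearMap.range_eq_top.2 hφ] at h1
    simp only [finrank_top, Module.finrank_prod, Module.finrank_self] at h1
    change 1 + 1 + Module.finrank F K = _ at h1
    omega
  have hEven := ih (Module.finrank F K) (by omega)
    (b.compl₁₂ K.subtype K.subtype) (fun y => halt y) (fun x hx => by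
      refine Subtype.ext (hb x fun y => ?_)
      have hy : y - b v y • w + b w y • v ∈ K := by
        simp [K, φ, hw, halt v, halt w, hskew w v]
      have h1 : b (x : V) (y - b v y • w + b w y • v) = 0 := hx ⟨_, hy⟩
      have h2 : b (x : V) w = 0 := by rw [hskew, (hK x).2, neg_zero]
      have h3 : b (x : V) v = 0 := by rw [hskew, (hK x).1, neg_zero]
      simpa [h2, h3] using h1) rfl
  rw [← hdim]
  exact hEven.add (by decide)

end Alternating

section Forms

variable {F : Type} [Field F] {A : Type} [Group A]
variable {U V : Type} [AddCommGroup U] [Module F U] [AddCommGroup V] [Module F V]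

lemma Nondeg.ext {b : U →ₗ[F] U →ₗ[F] F} (hb : Nondeg b) {u v : U}
    (h : ∀ w, b u w = b v w) : u = v :=
  sub_eq_zero.1 (hb _ fun w => by simp [h])

lemma Nondeg.exists_lift [FiniteDimensional F U] {b : U →ₗ[F] U →ₗ[F] F} (hb : Nondeg b)
    (l : V →ₗ[F] U →ₗ[F] F) : ∃ θ : V →ₗ[F] U, ∀ v u, b (θ v) u = l v u := by
  have hinj : Function.Injective b := fun x y h => hb.ext fun w => by rw [h]
  let e : U ≃ₗ[F] Dual F U := LinearMap.linearEquivOfInjective b hinj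
    (Subspace.dual_finrank_eq).symm
  refine ⟨e.symm.toLinearMap ∘ₗ l, fun v u => ?_⟩
  have h : e (e.symm (l v)) = l v := e.apply_symm_apply _
  exact LinearMap.congr_fun h u

lemma bilinInvariant_iff {ρ : Representation F A V} {b : V →ₗ[F] V →ₗ[F] F} :
    BilinInvariant ρ b ↔ b ∈ EquivHom ρ ρ.dual := by
  constructor
  · intro h g v
    ext w
    rw [dual_rep_apply, ← h g v, rep_apply_inv_self]
  · intro h g v w
    rw [h g v, dual_rep_apply, rep_inv_apply_self]

lemma IsIrred.nondeg {ρ : Representation F A V} (hρ : IsIrred ρ) {b : V →ₗ[F] V →ₗ[F] F}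
    (hb : BilinInvariant ρ b) (h0 : b ≠ 0) : Nondeg b := by
  intro v hv
  apply hρ.injective (bilinInvariant_iff.1 hb) h0
  rw [map_zero]
  exact LinearMap.ext hv

/-- In characteristic two, a self-dual irreducible representation carries a nondegenerate
symmetric invariant form. -/
lemma IsIrred.exists_symm_form [CharP F 2] {ρ : Representation F A V} (hρ : IsIrred ρ)
    (hsd : IsSelfDual ρ) : ∃ b : V →ₗ[F] V →ₗ[F] F,
      BilinInvariant ρ b ∧ Nondeg b ∧ ∀ x y, b x y = b y x := by
  obtain ⟨e, he⟩ := hsd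
  have := hρ.1
  have hb : BilinInvariant ρ e.toLinearMap := bilinInvariant_iff.2 he
  by_cases hc : e.toLinearMap + e.toLinearMap.flip = 0
  · refine ⟨e.toLinearMap, hb, hρ.nondeg hb ?_, fun x y => ?_⟩
    · intro h
      obtain ⟨v, hv⟩ := exists_ne (0 : V)
      exact hv (e.injective (by simpa using LinearMap.congr_fun h v))
    · have h1 := LinearMap.congr_fun (LinearMap.congr_fun hc x) y
      exact CharTwo.add_eq_zero.1 h1
  · have hinv : BilinInvariant ρ (e.toLinearMap + e.toLinearMap.flip) := fun g v w =>
      congrArg₂ (· + ·) (hb g v w) (hb g w v)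
    exact ⟨_, hinv, hρ.nondeg hinv hc, fun x y => add_comm _ _⟩

end Forms

section Inertia

variable {F : Type} [Field F] {A B : Type} [Group A] [Group B]
variable {U V : Type} [AddCommGroup U] [Module F U] [AddCommGroup V] [Module F V]

/-- An irreducible representation with scalar endomorphisms and a nondegenerate symmetric
invariant form, on a group embedded as a normal subgroup by `ι`. -/
structure NormalFormData (ι : A →* B) (σ : Representation F A U)
    (b : U →ₗ[F] U →ₗ[F] F) : Prop where
  inj : Function.Injective ι
  normal : ∀ g a, ∃ a', g * ι a * g⁻¹ = ι a'
  irr : IsIrred σ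
  schur : ∀ f ∈ EquivHom σ σ, ∃ c : F, f = c • (LinearMap.id : U →ₗ[F] U)
  inv : BilinInvariant σ b
  nondeg : Nondeg b
  symm : ∀ x y, b x y = b y x

/-- `f` intertwines `σ` with its conjugate by `g`. -/
def IsTwisted (ι : A →* B) (σ : Representation F A U) (g : B) (f : U →ₗ[F] U) : Prop :=
  ∀ a a', g * ι a * g⁻¹ = ι a' → ∀ u, f (σ a u) = σ a' (f u)

/-- `X` is an isometry of `b` intertwining `σ` with its conjugate by `g`. -/
def IsInertiaPair (ι : A →* B) (σ : Representation F A U) (b : U →ₗ[F] U →ₗ[F] F)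
    (g : B) (X : U ≃ₗ[F] U) : Prop :=
  IsTwisted ι σ g X.toLinearMap ∧ ∀ u u', b (X u) (X u') = b u u'

variable {ι : A →* B} {σ : Representation F A U} {b : U →ₗ[F] U →ₗ[F] F}

namespace IsInertiaPair

variable {g g' : B} {X X' : U ≃ₗ[F] U}

lemma apply (h : IsInertiaPair ι σ b g X) {a a' : A} (ha : g * ι a * g⁻¹ = ι a') (u : U) :
    X (σ a u) = σ a' (X u) := h.1 a a' ha u

lemma mul (D : NormalFormData ι σ b) (h : IsInertiaPair ι σ b g X)
    (h' : IsInertiaPair ι σ b g' X') : IsInertiaPair ι σ b (g * g') (X'.trans X) := by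
  refine ⟨fun a a' ha u => ?_, fun u u' => by simp [h.2, h'.2]⟩
  obtain ⟨a₁, ha₁⟩ := D.normal g' a
  change X (X' (σ a u)) = σ a' (X (X' u))
  rw [h'.apply ha₁, h.apply]
  rw [← ha, ← ha₁]
  group

lemma inv (h : IsInertiaPair ι σ b g X) : IsInertiaPair ι σ b g⁻¹ X.symm := by
  refine ⟨fun a a' ha u => X.injective ?_, fun u u' => ?_⟩
  · change X (X.symm (σ a u)) = X (σ a' (X.symm u))
    rw [h.apply (a' := a), X.apply_symm_apply, X.apply_symm_apply]
    rw [← ha]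
    group
  · rw [← h.2]
    simp

lemma of_map (D : NormalFormData ι σ b) (a : A) : ∃ X : U ≃ₗ[F] U,
    (∀ u, X u = σ a u) ∧ IsInertiaPair ι σ b (ι a) X := by
  refine ⟨LinearEquiv.ofLinearMap (σ a) (σ a⁻¹)
    (LinearMap.ext fun u => rep_apply_inv_self σ a u)
    (LinearMap.ext fun u => rep_inv_apply_self σ a u), fun u => rfl, fun a₁ a' ha u => ?_,
    fun u u' => D.inv a u u'⟩
  change σ a (σ a₁ u) = σ a' (σ a u)
  have : a' = a * a₁ * a⁻¹ := D.inj (by rw [← ha]; simp)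
  rw [this, map_mul, map_mul, Module.End.mul_apply, Module.End.mul_apply, rep_inv_apply_self]

end IsInertiaPair

namespace NormalFormData

lemma exists_eq_one (D : NormalFormData ι σ b) : ∃ u u', b u u' = 1 := by
  have := D.irr.1
  obtain ⟨u, hu⟩ := exists_ne (0 : U)
  obtain ⟨w, hw⟩ : ∃ w, b u w ≠ 0 := by
    by_contra! h
    exact hu (D.nondeg u h)
  exact ⟨u, (b u w)⁻¹ • w, by simp [hw]⟩

lemma eq_of_isInertiaPair [CharP F 2] (D : NormalFormData ι σ b) {g : B} {X Y : U ≃ₗ[F] U}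
    (hX : IsInertiaPair ι σ b g X) (hY : IsInertiaPair ι σ b g Y) : X = Y := by
  obtain ⟨c, hc⟩ := D.schur (Y.symm.toLinearMap ∘ₗ X.toLinearMap) (fun a u => by
    obtain ⟨a', ha'⟩ := D.normal g a
    apply Y.injective
    change Y (Y.symm (X (σ a u))) = Y (σ a (Y.symm (X u)))
    rw [hY.apply ha', Y.apply_symm_apply, Y.apply_symm_apply, hX.apply ha'])
  have hXY : ∀ u, X u = c • Y u := fun u => by
    have h : Y.symm (X u) = c • u := LinearMap.congr_fun hc u
    rw [← map_smul, ← h, Y.apply_symm_apply]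
  obtain ⟨u, u', h1⟩ := D.exists_eq_one
  have h2 := hX.2 u u'
  rw [hXY, hXY, map_smul, map_smul, LinearMap.smul_apply, hY.2, h1, smul_eq_mul, smul_eq_mul,
    mul_one] at h2
  have hc1 : c = 1 := by
    rcases mul_self_eq_one_iff.1 h2 with h | h
    · exact h
    · rw [h, CharTwo.neg_eq]
  ext u
  rw [hXY, hc1, one_smul]

lemma exists_smul_form [FiniteDimensional F U] (D : NormalFormData ι σ b)
    {c : U →ₗ[F] U →ₗ[F] F} (hc : BilinInvariant σ c) : ∃ k, ∀ u u', c u u' = k * b u u' := by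
  obtain ⟨θ, hθ⟩ := D.nondeg.exists_lift c
  obtain ⟨k, hk⟩ := D.schur θ (fun a u => D.nondeg.ext fun w => by
    have h1 := D.inv a (θ u) (σ a⁻¹ w)
    have h2 := hc a u (σ a⁻¹ w)
    rw [rep_apply_inv_self] at h1 h2
    rw [hθ, h1, h2, hθ])
  refine ⟨k, fun u u' => ?_⟩
  rw [← hθ, hk]
  simp

/-- A nonzero twisted endomorphism can be rescaled to an isometry. -/
lemma exists_isInertiaPair [CharP F 2] [PerfectField F] [FiniteDimensional F U]
    (D : NormalFormData ι σ b) {g : B} {f : U →ₗ[F] U} (hf : IsTwisted ι σ g f) (h0 : f ≠ 0) :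
    ∃ (X : U ≃ₗ[F] U) (d : F), d ≠ 0 ∧ (∀ u, X u = d • f u) ∧ IsInertiaPair ι σ b g X := by
  have hinj : Function.Injective f := by
    have hker : IsSubrep σ (LinearMap.ker f) := by
      intro a u hu
      obtain ⟨a', ha'⟩ := D.normal g a
      rw [LinearMap.mem_ker] at *
      rw [hf a a' ha', hu, map_zero]
    rcases D.irr.2 _ hker with h | h
    · exact LinearMap.ker_eq_bot.1 h
    · exact absurd (LinearMap.ker_eq_top.1 h) h0
  have hbij : Function.Bijective f := ⟨hinj, LinearMap.injective_iff_surjective.1 hinj⟩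
  obtain ⟨k, hk⟩ := D.exists_smul_form (c := b.compl₁₂ f f) (fun a u u' => by
    obtain ⟨a', ha'⟩ := D.normal g a
    simp only [LinearMap.compl₁₂_apply]
    rw [hf a a' ha', hf a a' ha', D.inv])
  simp only [LinearMap.compl₁₂_apply] at hk
  have hk0 : k ≠ 0 := by
    rintro rfl
    obtain ⟨u, u', h1⟩ := D.exists_eq_one
    obtain ⟨v, rfl⟩ := hbij.2 u
    obtain ⟨v', rfl⟩ := hbij.2 u'
    rw [hk, zero_mul] at h1
    exact zero_ne_one h1
  have : Fact (Nat.Prime 2) := ⟨Nat.prime_two⟩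
  obtain ⟨d, rfl⟩ : ∃ d : F, d ^ 2 = k := ⟨_, frobeniusEquiv_symm_pow_p F 2 k⟩
  have hd : d ≠ 0 := by
    rintro rfl
    exact hk0 (by simp)
  refine ⟨(LinearEquiv.ofBijective f hbij).trans (LinearEquiv.smulOfNeZero F U d⁻¹
    (inv_ne_zero hd)), d⁻¹, inv_ne_zero hd, fun u => rfl, fun a a' ha u => ?_, fun u u' => ?_⟩
  · change d⁻¹ • f (σ a u) = σ a' (d⁻¹ • f u)
    rw [hf a a' ha, map_smul]
  · change b (d⁻¹ • f u) (d⁻¹ • f u') = b u u'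
    rw [map_smul, map_smul, LinearMap.smul_apply, hk, smul_eq_mul, smul_eq_mul]
    field_simp

end NormalFormData

end Inertia

section NormalCase

variable {F : Type} [Field F] {A B : Type} [Group A] [Group B]
variable {U V : Type} [AddCommGroup U] [Module F U] [AddCommGroup V] [Module F V]
variable (ι : A →* B) (σ : Representation F A U) (b : U →ₗ[F] U →ₗ[F] F)

/-- The space of the representation induced from the canonical extension of `σ` to the elements
of `B` admitting an isometric intertwiner. -/
def indSubmodule : Submodule F (B → U) where
  carrier := {φ | ∀ g x X, IsInertiaPair ι σ b x X → φ g = X (φ (g * x))}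
  add_mem' h h' g x X hX := by
    rw [Pi.add_apply, Pi.add_apply, map_add, ← h g x X hX, ← h' g x X hX]
  zero_mem' g x X _ := by simp
  smul_mem' c φ h g x X hX := by
    rw [Pi.smul_apply, Pi.smul_apply, map_smul, ← h g x X hX]

/-- The underlying space of the induced representation. -/
def IndSpace : Type := indSubmodule ι σ b

noncomputable instance : AddCommGroup (IndSpace ι σ b) :=
  inferInstanceAs (AddCommGroup (indSubmodule ι σ b))

noncomputable instance : Module F (IndSpace ι σ b) :=
  inferInstanceAs (Module F (indSubmodule ι σ b))

instance [Finite B] [FiniteDimensional F U] : FiniteDimensional F (IndSpace ι σ b) :=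
  inferInstanceAs (FiniteDimensional F (indSubmodule ι σ b))

variable {ι σ b} in
lemma IndSpace.ext {φ ψ : IndSpace ι σ b} (h : ∀ g, φ.1 g = ψ.1 g) : φ = ψ :=
  Subtype.ext (funext h)

/-- Left translation on `IndSpace ι σ b`. -/
noncomputable def indRep : Representation F B (IndSpace ι σ b) where
  toFun k :=
    { toFun := fun φ => ⟨fun g => φ.1 (k⁻¹ * g), fun g x X hX => by
        change φ.1 (k⁻¹ * g) = X (φ.1 (k⁻¹ * (g * x)))
        rw [← mul_assoc]
        exact φ.2 (k⁻¹ * g) x X hX⟩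
      map_add' := fun φ ψ => rfl
      map_smul' := fun c φ => rfl }
  map_one' := LinearMap.ext fun φ => IndSpace.ext fun g => by
    change φ.1 (1⁻¹ * g) = φ.1 g
    rw [inv_one, one_mul]
  map_mul' k l := LinearMap.ext fun φ => IndSpace.ext fun g => by
    change φ.1 ((k * l)⁻¹ * g) = φ.1 (l⁻¹ * (k⁻¹ * g))
    rw [mul_inv_rev, mul_assoc]

open Classical in
/-- The inverse of the isometric intertwiner attached to `g`, or zero if there is none. -/
noncomputable def inertiaInv (g : B) : U →ₗ[F] U :=
  if h : ∃ X, IsInertiaPair ι σ b g X then h.choose.symm.toLinearMap else 0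

variable {ι σ b}

@[simp]
lemma indRep_apply (k g : B) (φ : IndSpace ι σ b) :
    (indRep ι σ b k φ).1 g = φ.1 (k⁻¹ * g) := rfl

lemma indSpace_apply_mul_map (D : NormalFormData ι σ b) (φ : IndSpace ι σ b) (g : B)
    (a : A) : φ.1 (g * ι a) = σ a⁻¹ (φ.1 g) := by
  obtain ⟨X, hX, hp⟩ := IsInertiaPair.of_map D a
  rw [φ.2 g _ X hp, hX, rep_inv_apply_self]

namespace NormalFormData

lemma inertiaInv_eq_zero {g : B} (h : ¬ ∃ X, IsInertiaPair ι σ b g X) (u : U) :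
    inertiaInv ι σ b g u = 0 := by
  rw [inertiaInv, dif_neg h]
  rfl

lemma isInertiaPair_one (D : NormalFormData ι σ b) :
    IsInertiaPair ι σ b 1 (LinearEquiv.refl F U) := by
  refine ⟨fun a a' h u => ?_, fun _ _ => rfl⟩
  rw [one_mul, inv_one, mul_one] at h
  rw [D.inj h]
  rfl

variable [CharP F 2]

lemma inertiaInv_eq (D : NormalFormData ι σ b) {g : B} {X : U ≃ₗ[F] U}
    (hX : IsInertiaPair ι σ b g X) (u : U) : inertiaInv ι σ b g u = X.symm u := by
  have h : ∃ X, IsInertiaPair ι σ b g X := ⟨X, hX⟩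
  rw [inertiaInv, dif_pos h, D.eq_of_isInertiaPair h.choose_spec hX]
  rfl

/-- The embedding of `σ` into the induced representation. -/
noncomputable def indEmb (D : NormalFormData ι σ b) : U →ₗ[F] IndSpace ι σ b where
  toFun u := ⟨fun g => inertiaInv ι σ b g u, fun g x X hX => by
    change inertiaInv ι σ b g u = X (inertiaInv ι σ b (g * x) u)
    by_cases h : ∃ Z, IsInertiaPair ι σ b g Z
    · obtain ⟨Z, hZ⟩ := h
      rw [D.inertiaInv_eq hZ, D.inertiaInv_eq (hZ.mul D hX)]
      simp
    · have h' : ¬ ∃ Z, IsInertiaPair ι σ b (g * x) Z := by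
        rintro ⟨Z, hZ⟩
        have := hZ.mul D hX.inv
        rw [mul_inv_cancel_right] at this
        exact h ⟨_, this⟩
      rw [inertiaInv_eq_zero h, inertiaInv_eq_zero h', map_zero]⟩
  map_add' u u' := IndSpace.ext fun g => map_add (inertiaInv ι σ b g) _ _
  map_smul' c u := IndSpace.ext fun g => map_smul (inertiaInv ι σ b g) _ _

lemma indEmb_apply (D : NormalFormData ι σ b) (u : U) (g : B) :
    (D.indEmb u).1 g = inertiaInv ι σ b g u := rfl

lemma indEmb_apply_one (D : NormalFormData ι σ b) (u : U) : (D.indEmb u).1 1 = u := by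
  rw [indEmb_apply, D.inertiaInv_eq D.isInertiaPair_one]
  rfl

lemma indEmb_ne_zero (D : NormalFormData ι σ b) : D.indEmb ≠ 0 := by
  intro h
  have := D.irr.1
  obtain ⟨u, hu⟩ := exists_ne (0 : U)
  apply hu
  rw [← D.indEmb_apply_one u, h]
  rfl

lemma indEmb_apply_pair (D : NormalFormData ι σ b) {k : B} {Z : U ≃ₗ[F] U}
    (hZ : IsInertiaPair ι σ b k Z) (u : U) : D.indEmb (Z u) = indRep ι σ b k (D.indEmb u) := by
  refine IndSpace.ext fun g => ?_
  rw [indRep_apply, indEmb_apply, indEmb_apply]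
  by_cases h : ∃ W, IsInertiaPair ι σ b g W
  · obtain ⟨W, hW⟩ := h
    rw [D.inertiaInv_eq hW, D.inertiaInv_eq (hZ.inv.mul D hW)]
    simp
  · have h' : ¬ ∃ W, IsInertiaPair ι σ b (k⁻¹ * g) W := by
      rintro ⟨W, hW⟩
      have := hZ.mul D hW
      rw [mul_inv_cancel_left] at this
      exact h ⟨_, this⟩
    rw [inertiaInv_eq_zero h, inertiaInv_eq_zero h']

lemma indEmb_mem (D : NormalFormData ι σ b) :
    D.indEmb ∈ EquivHom σ ((indRep ι σ b).comp ι) := by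
  intro a u
  obtain ⟨X, hX, hp⟩ := IsInertiaPair.of_map D a
  rw [← hX, D.indEmb_apply_pair hp]
  rfl

lemma indRep_indEmb_apply (D : NormalFormData ι σ b) (φ : IndSpace ι σ b) (g y : B) :
    (indRep ι σ b g (D.indEmb (φ.1 g))).1 y = φ.1 y ∨
      (indRep ι σ b g (D.indEmb (φ.1 g))).1 y = 0 := by
  rw [indRep_apply, indEmb_apply]
  by_cases h : ∃ X, IsInertiaPair ι σ b (g⁻¹ * y) X
  · obtain ⟨X, hX⟩ := h
    left
    rw [D.inertiaInv_eq hX, φ.2 g _ X hX, X.symm_apply_apply, mul_inv_cancel_left]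
  · exact Or.inr (inertiaInv_eq_zero h _)

lemma indRep_indEmb_apply_self (D : NormalFormData ι σ b) (φ : IndSpace ι σ b) (g : B) :
    (indRep ι σ b g (D.indEmb (φ.1 g))).1 g = φ.1 g := by
  rw [indRep_apply, inv_mul_cancel, indEmb_apply_one]

lemma eq_top_of_forall_indEmb_mem [Finite B] (D : NormalFormData ι σ b)
    {N : Submodule F (IndSpace ι σ b)} (hN : IsSubrep (indRep ι σ b) N)
    (h : ∀ u, D.indEmb u ∈ N) : N = ⊤ := by
  rw [eq_top_iff]
  rintro φ -
  induction hn : {y | φ.1 y ≠ 0}.ncard using Nat.strong_induction_on generalizing φ with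
  | _ n ih =>
    by_cases h0 : φ = 0
    · rw [h0]
      exact N.zero_mem
    obtain ⟨g, hg⟩ : ∃ g, φ.1 g ≠ 0 := by
      by_contra! hall
      exact h0 (IndSpace.ext hall)
    have hmem := hN g _ (h (φ.1 g))
    rw [← sub_add_cancel φ (indRep ι σ b g (D.indEmb (φ.1 g)))]
    refine N.add_mem (ih _ ?_ rfl) hmem
    rw [← hn]
    refine Set.ncard_lt_ncard ⟨fun y hy hy0 => hy ?_, fun hsub => hsub hg ?_⟩
    · change φ.1 y - _ = 0
      rcases D.indRep_indEmb_apply φ g y with h | h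
      · rw [h, sub_self]
      · rw [h, hy0, sub_zero]
    · change φ.1 g - _ = 0
      rw [D.indRep_indEmb_apply_self, sub_self]

variable [PerfectField F] [FiniteDimensional F U]

lemma exists_eq_smul_indEmb (D : NormalFormData ι σ b) {f : U →ₗ[F] IndSpace ι σ b}
    (hf : f ∈ EquivHom σ ((indRep ι σ b).comp ι)) : ∃ c : F, f = c • D.indEmb := by
  have key : ∀ u a g, (f (σ a u)).1 g = (f u).1 (ι a⁻¹ * g) := fun u a g => by
    rw [hf a u, map_inv]
    rfl
  let ev : B → U →ₗ[F] U := fun g =>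
    { toFun := fun u => (f u).1 g
      map_add' := fun u u' => by rw [map_add]; rfl
      map_smul' := fun c u => by rw [map_smul]; rfl }
  have htw : ∀ g, IsTwisted ι σ g⁻¹ (ev g) := fun g a a' ha u => by
    change (f (σ a u)).1 g = σ a' ((f u).1 g)
    have h1 : ι a⁻¹ * g = g * ι a'⁻¹ := by
      rw [map_inv ι a', ← ha, map_inv]
      group
    rw [key, h1, indSpace_apply_mul_map D, inv_inv]
  obtain ⟨c, hc⟩ := D.schur (ev 1) (fun a u => by
    have := htw 1 a a (by group) u
    exact this)
  refine ⟨c, LinearMap.ext fun u => IndSpace.ext fun g => ?_⟩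
  have hc' : (f u).1 1 = c • u := LinearMap.congr_fun hc u
  change (f u).1 g = c • inertiaInv ι σ b g u
  by_cases h : ∃ X, IsInertiaPair ι σ b g X
  · obtain ⟨X, hX⟩ := h
    rw [(f u).2 1 g X hX, one_mul] at hc'
    rw [D.inertiaInv_eq hX, ← map_smul, ← hc', X.symm_apply_apply]
  · rw [inertiaInv_eq_zero h, smul_zero]
    by_contra h0
    obtain ⟨X, d, -, -, hX⟩ := D.exists_isInertiaPair (htw g)
      (fun h' => h0 (LinearMap.congr_fun h' u))
    have := hX.inv
    rw [inv_inv] at this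
    exact h ⟨_, this⟩

lemma repMult_indRep (D : NormalFormData ι σ b) : repMult σ ((indRep ι σ b).comp ι) = 1 := by
  refine finrank_eq_one (⟨D.indEmb, D.indEmb_mem⟩) ?_ ?_
  · exact fun h => D.indEmb_ne_zero (congrArg Subtype.val h)
  · rintro ⟨f, hf⟩
    obtain ⟨c, rfl⟩ := D.exists_eq_smul_indEmb hf
    exact ⟨c, rfl⟩

lemma isIrred_indRep [Finite B] (D : NormalFormData ι σ b) : IsIrred (indRep ι σ b) := by
  have hnt : Nontrivial (IndSpace ι σ b) := by
    obtain ⟨u, hu⟩ : ∃ u, D.indEmb u ≠ 0 := by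
      by_contra! h
      exact D.indEmb_ne_zero (LinearMap.ext h)
    exact ⟨_, _, hu⟩
  refine ⟨hnt, fun N hN => or_iff_not_imp_left.2 fun hbot => ?_⟩
  have : Nontrivial N := Submodule.nontrivial_iff_ne_bot.2 hbot
  obtain ⟨p, hp, hirr⟩ := exists_irred_subrep (subRep _ N hN)
  have hss := hirr.isSemisimpleRep_comp ι D.normal
  let ev : p →ₗ[F] U :=
    { toFun := fun φ => φ.1.1.1 1
      map_add' := fun φ ψ => rfl
      map_smul' := fun c φ => rfl }
  have hev : ev ∈ EquivHom ((subRep (subRep _ N hN) p hp).comp ι) σ := fun a φ => by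
    change φ.1.1.1 ((ι a)⁻¹ * 1) = σ a (φ.1.1.1 1)
    have := indSpace_apply_mul_map D φ.1.1 1 a⁻¹
    rw [inv_inv, one_mul, map_inv] at this
    rw [← this, mul_one]
  have hev0 : ev ≠ 0 := by
    have := hirr.1
    obtain ⟨φ, hφ⟩ := exists_ne (0 : p)
    obtain ⟨g, hg⟩ : ∃ g, φ.1.1.1 g ≠ 0 := by
      by_contra! h
      exact hφ (Subtype.ext (Subtype.ext (IndSpace.ext h)))
    intro h
    have h2 : φ.1.1.1 (g⁻¹⁻¹ * 1) = 0 :=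
      LinearMap.congr_fun h (subRep (subRep _ N hN) p hp g⁻¹ φ)
    rw [inv_inv, mul_one] at h2
    exact hg h2
  have hne := (repMult_pos hev hev0).ne'
  rw [← D.irr.repMult_comm_of_isSemisimpleRep hss] at hne
  obtain ⟨f, hf, hf0⟩ := exists_ne_zero_of_repMult_ne_zero hne
  obtain ⟨c, hc⟩ := D.exists_eq_smul_indEmb (f := N.subtype ∘ₗ p.subtype ∘ₗ f) (fun a u => by
    change ((f (σ a u)).1.1 : IndSpace ι σ b) = _
    rw [hf a u]
    rfl)
  have hc' : ∀ u, ((f u).1.1 : IndSpace ι σ b) = c • D.indEmb u := LinearMap.congr_fun hc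
  have hc0 : c ≠ 0 := by
    rintro rfl
    refine hf0 (LinearMap.ext fun u => Subtype.ext (Subtype.ext ?_))
    rw [hc', zero_smul]
    rfl
  refine D.eq_top_of_forall_indEmb_mem hN fun u => ?_
  rw [← inv_smul_smul₀ hc0 (D.indEmb u), ← hc']
  exact N.smul_mem _ (f u).1.2

lemma repIso_indRep [Finite B] (D : NormalFormData ι σ b) {κ : Representation F B V}
    (hκ : IsIrred κ) {θ : V →ₗ[F] U} (h0 : θ ≠ 0)
    (hθ : ∀ x X, IsInertiaPair ι σ b x X → ∀ v, θ (κ x v) = X (θ v)) :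
    RepIso κ (indRep ι σ b) := by
  let Φ : V →ₗ[F] IndSpace ι σ b :=
    { toFun := fun v => ⟨fun g => θ (κ g⁻¹ v), fun g x X hX => by
        change θ (κ g⁻¹ v) = X (θ (κ (g * x)⁻¹ v))
        rw [← hθ x X hX, mul_inv_rev, map_mul, Module.End.mul_apply, rep_apply_inv_self]⟩
      map_add' := fun v w => IndSpace.ext fun g => (θ ∘ₗ κ g⁻¹).map_add v w
      map_smul' := fun c v => IndSpace.ext fun g => (θ ∘ₗ κ g⁻¹).map_smul c v }
  refine hκ.repIso D.isIrred_indRep (f := Φ) (fun k v => ?_) fun h => h0 (LinearMap.ext fun v => ?_)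
  · refine IndSpace.ext fun g => ?_
    change θ (κ g⁻¹ (κ k v)) = θ (κ (k⁻¹ * g)⁻¹ v)
    rw [mul_inv_rev, inv_inv, map_mul, Module.End.mul_apply]
  · have h1 : θ (κ 1⁻¹ v) = 0 :=
      congrFun (congrArg Subtype.val (LinearMap.congr_fun h v)) 1
    simpa using h1

lemma repIso_dual_indRep [Finite B] [FiniteDimensional F V] (D : NormalFormData ι σ b)
    {κ : Representation F B V} (hκ : IsIrred κ) {f : U →ₗ[F] V} (h0 : f ≠ 0)
    (hf : ∀ x X, IsInertiaPair ι σ b x X → ∀ u, f (X u) = κ x (f u)) :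
    RepIso κ.dual (indRep ι σ b) := by
  obtain ⟨θ, hθ⟩ := D.nondeg.exists_lift (LinearMap.lcomp F F f)
  simp only [LinearMap.lcomp_apply] at hθ
  refine D.repIso_indRep hκ.dual (θ := θ) (fun h => h0 ?_) fun x X hX ξ => D.nondeg.ext fun u => ?_
  · ext u
    rw [LinearMap.zero_apply, ← Module.forall_dual_apply_eq_zero_iff F]
    intro ξ
    rw [← hθ, h]
    simp
  · obtain ⟨w, rfl⟩ := X.surjective u
    rw [hX.2, hθ, hθ, dual_rep_apply, hf x X hX, rep_inv_apply_self]

lemma isSelfDual_indRep [Finite B] (D : NormalFormData ι σ b) : IsSelfDual (indRep ι σ b) :=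
  (D.repIso_dual_indRep D.isIrred_indRep D.indEmb_ne_zero
    fun _ _ hX u => D.indEmb_apply_pair hX u).symm

end NormalFormData

lemma IsInertiaPair.comp_mem (D : NormalFormData ι σ b) {κ : Representation F B V} {g : B}
    {X : U ≃ₗ[F] U} (hX : IsInertiaPair ι σ b g X) {f : U →ₗ[F] V}
    (hf : f ∈ EquivHom σ (κ.comp ι)) :
    κ g ∘ₗ f ∘ₗ X.symm.toLinearMap ∈ EquivHom σ (κ.comp ι) := by
  intro a u
  obtain ⟨a', ha'⟩ := D.normal g⁻¹ a
  change κ g (f (X.symm (σ a u))) = κ (ι a) (κ g (f (X.symm u)))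
  have h : f (σ a' (X.symm u)) = κ (ι a') (f (X.symm u)) := hf a' _
  rw [hX.inv.apply ha', h, ← ha', ← Module.End.mul_apply, ← map_mul, ← Module.End.mul_apply,
    ← map_mul]
  group

end NormalCase

section Uniqueness

variable {F : Type} [Field F] [CharP F 2] [PerfectField F]

/-- In characteristic two, a nondegenerate symmetric form on a space of odd dimension has a
nonzero vector fixed by all its surjective isometries. -/
lemma Nondeg.exists_fixed {E : Type} [AddCommGroup E] [Module F E] [FiniteDimensional F E]
    {β : E →ₗ[F] E →ₗ[F] F} (hβ : Nondeg β) (hsymm : ∀ x y, β x y = β y x)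
    (hodd : Odd (finrank F E)) :
    ∃ x : E, x ≠ 0 ∧ ∀ T : E → E, Function.Surjective T →
      (∀ y z, β (T y) (T z) = β y z) → T x = x := by
  have : Fact (Nat.Prime 2) := ⟨Nat.prime_two⟩
  have hinj : Function.Injective fun a : F => a ^ 2 := (frobeniusEquiv F 2).injective
  choose r hr using fun x => (⟨_, frobeniusEquiv_symm_pow_p F 2 (β x x)⟩ : ∃ d, d ^ 2 = β x x)
  let l : E →ₗ[F] F :=
    { toFun := r
      map_add' := fun x y => hinj (by
        change r (x + y) ^ 2 = (r x + r y) ^ 2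
        rw [CharTwo.add_sq, hr, hr, hr]
        simp only [map_add, LinearMap.add_apply, hsymm y x]
        have := CharTwo.add_self_eq_zero (β x y)
        linear_combination this)
      map_smul' := fun c x => hinj (by
        change r (c • x) ^ 2 = (c * r x) ^ 2
        rw [mul_pow, hr, hr]
        simp only [map_smul, LinearMap.smul_apply, smul_eq_mul]
        ring) }
  obtain ⟨θ, hθ⟩ := hβ.exists_lift (LinearMap.toSpanSingleton F (Dual F E) l)
  have hx : ∀ y, β (θ 1) y ^ 2 = β y y := fun y => by
    rw [hθ, LinearMap.toSpanSingleton_apply, one_smul]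
    exact hr y
  refine ⟨θ 1, fun h0 => ?_, fun T hT hTβ => hβ.ext fun z => ?_⟩
  · refine Nat.not_even_iff_odd.2 hodd (even_finrank_of_isAltForm β (fun y => ?_) hβ)
    rw [← hx, h0]
    simp
  · obtain ⟨y, rfl⟩ := hT z
    apply hinj
    change β (T (θ 1)) (T y) ^ 2 = β (θ 1) (T y) ^ 2
    rw [hTβ, hx, hx, hTβ]

variable {A B : Type} [Group A] [Group B]
variable {U V : Type} [AddCommGroup U] [Module F U] [AddCommGroup V] [Module F V]
variable {ι : A →* B} {σ : Representation F A U} {b : U →ₗ[F] U →ₗ[F] F}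

namespace NormalFormData

/-- A self-dual irreducible representation containing `σ` with odd multiplicity is the
induced one. -/
lemma repIso_indRep_of_odd [Finite B] [FiniteDimensional F U] [FiniteDimensional F V]
    (D : NormalFormData ι σ b) {κ : Representation F B V} (hκ : IsIrred κ)
    (hsd : IsSelfDual κ) (hodd : Odd (repMult σ (κ.comp ι))) : RepIso κ (indRep ι σ b) := by
  obtain ⟨C, hCinv, hC, hCsymm⟩ := hκ.exists_symm_form hsd
  obtain ⟨u₀, u₁, h1⟩ := D.exists_eq_one
  let ev : U → EquivHom σ (κ.comp ι) →ₗ[F] V := fun u =>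
    LinearMap.applyₗ u ∘ₗ (EquivHom σ (κ.comp ι)).subtype
  let β : EquivHom σ (κ.comp ι) →ₗ[F] EquivHom σ (κ.comp ι) →ₗ[F] F :=
    C.compl₁₂ (ev u₀) (ev u₁)
  have hβ : ∀ f f', β f f' = C (f.1 u₀) (f'.1 u₁) := fun f f' => rfl
  have key : ∀ f f' u u', C (f.1 u) (f'.1 u') = β f f' * b u u' := fun f f' u u' => by
    obtain ⟨k, hk⟩ := D.exists_smul_form (c := C.compl₁₂ f.1 f'.1) (fun a u u' => by
      simp only [LinearMap.compl₁₂_apply]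
      rw [f.2 a, f'.2 a]
      exact hCinv _ _ _)
    simp only [LinearMap.compl₁₂_apply] at hk
    rw [hβ, hk, hk, h1, mul_one]
  have hβsymm : ∀ f f', β f f' = β f' f := fun f f' => by
    rw [hβ, hCsymm, key, D.symm, h1, mul_one]
  have hβnd : Nondeg β := by
    intro f hf
    by_contra h0
    obtain ⟨u, hu⟩ : ∃ u, f.1 u ≠ 0 := by
      by_contra! h
      exact h0 (Subtype.ext (LinearMap.ext h))
    obtain ⟨θ, hθ⟩ := D.nondeg.exists_lift (C.compl₁₂ LinearMap.id f.1)
    simp only [LinearMap.compl₁₂_apply, LinearMap.id_apply] at hθ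
    have hθmem : ∀ a v, θ (κ (ι a) v) = σ a (θ v) := fun a v => D.nondeg.ext fun w => by
      have h2 := D.inv a (θ v) (σ a⁻¹ w)
      have h3 : f.1 (σ a (σ a⁻¹ w)) = κ (ι a) (f.1 (σ a⁻¹ w)) := f.2 a _
      rw [rep_apply_inv_self] at h2 h3
      rw [hθ, h2, hθ, h3, hCinv]
    obtain ⟨g, hg⟩ : ∃ g, θ (κ g (f.1 u)) ≠ 0 := by
      by_contra! h
      have h4 : ∀ v, θ v = 0 := hκ.forall_mem_of_forall_apply_mem (LinearMap.ker θ) hu h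
      refine hu (hC _ fun v => ?_)
      rw [hCsymm, ← hθ, h4]
      simp
    obtain ⟨X, d, hd, hXd, hX⟩ := D.exists_isInertiaPair (g := g) (f := θ ∘ₗ κ g ∘ₗ f.1)
      (fun a a' ha w => by
        change θ (κ g (f.1 (σ a w))) = σ a' (θ (κ g (f.1 w)))
        have h5 : f.1 (σ a w) = κ (ι a) (f.1 w) := f.2 a w
        rw [h5, ← hθmem, ← ha, ← Module.End.mul_apply, ← map_mul, ← Module.End.mul_apply,
          ← map_mul]
        group)
      (fun h => hg (LinearMap.congr_fun h u))
    let f' : EquivHom σ (κ.comp ι) := ⟨_, hX.comp_mem D f.2⟩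
    have h6 := hXd (X.symm u₀)
    have h7 : θ (f'.1 u₀) = (θ ∘ₗ κ g ∘ₗ f.1) (X.symm u₀) := rfl
    rw [X.apply_symm_apply, ← h7] at h6
    have h8 := key f' f u₀ u₁
    rw [hβsymm, hf, zero_mul, ← hθ] at h8
    rw [h6, map_smul, LinearMap.smul_apply, h8, smul_zero] at h1
    exact zero_ne_one h1
  obtain ⟨f₀, hf₀, hfix⟩ := hβnd.exists_fixed hβsymm hodd
  refine RepIso.trans hsd (D.repIso_dual_indRep hκ (f := f₀.1)
    (fun h => hf₀ (Subtype.ext h)) fun x X hX u => ?_)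
  have h := hfix (fun f => ⟨_, hX.comp_mem D f.2⟩) (fun f => ?_) (fun f f' => ?_)
  · have h' : κ x (f₀.1 (X.symm (X u))) = f₀.1 (X u) :=
      LinearMap.congr_fun (congrArg Subtype.val h) (X u)
    rw [← h', X.symm_apply_apply]
  · refine ⟨⟨_, hX.inv.comp_mem D f.2⟩, Subtype.ext (LinearMap.ext fun u => ?_)⟩
    change κ x (κ x⁻¹ (f.1 (X (X.symm u)))) = f.1 u
    rw [rep_apply_inv_self, X.apply_symm_apply]
  · have h2 := key ⟨_, hX.comp_mem D f.2⟩ ⟨_, hX.comp_mem D f'.2⟩ (X u₀) (X u₁)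
    rw [hX.2, h1, mul_one] at h2
    rw [← h2, hβ]
    change C (κ x (f.1 (X.symm (X u₀)))) (κ x (f'.1 (X.symm (X u₁)))) = _
    rw [X.symm_apply_apply, X.symm_apply_apply, hCinv]

end NormalFormData

end Uniqueness

section Chain

variable {F : Type} [Field F]

/-- The representation `ρ` is a self-dual irreducible representation of finite dimension whose
restriction along `ι` contains `σ` with odd multiplicity. -/
def IsOddOver {A B U V : Type} [Group A] [Group B] [AddCommGroup U] [Module F U]
    [AddCommGroup V] [Module F V] (ι : A →* B) (σ : Representation F A U)
    (ρ : Representation F B V) : Prop :=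
  FiniteDimensional F V ∧ IsIrred ρ ∧ IsSelfDual ρ ∧ Odd (repMult σ (ρ.comp ι))

/-- Every self-dual irreducible representation of `A` has odd multiplicity in a unique self-dual
irreducible representation of `B`, and its multiplicities as a submodule and as a quotient of
restrictions of irreducible representations agree. -/
def HasUniqueOdd (F : Type) [Field F] {A B : Type} [Group A] [Group B] (ι : A →* B) : Prop :=
  ∀ (U : Type) [AddCommGroup U] [Module F U] (σ : Representation F A U),
    FiniteDimensional F U → IsIrred σ → IsSelfDual σ →
      (∃ M : RepOn F B, IsOddOver ι σ M.rep) ∧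
      (∀ M₁ M₂ : RepOn F B, IsOddOver ι σ M₁.rep → IsOddOver ι σ M₂.rep →
        RepIso M₁.rep M₂.rep) ∧
      ∀ (S : Type) [AddCommGroup S] [Module F S] (τ : Representation F B S),
        FiniteDimensional F S → IsIrred τ → repMult σ (τ.comp ι) = repMult (τ.comp ι) σ

variable {A B C : Type} [Group A] [Group B] [Group C]

lemma hasUniqueOdd_of_normal [CharP F 2] [PerfectField F] [Finite B] {ι : A →* B}
    (hinj : Function.Injective ι) (hn : ∀ g a, ∃ a', g * ι a * g⁻¹ = ι a')
    (hA : IsSplitting F A) : HasUniqueOdd F ι := by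
  intro U _ _ σ hU hσ hsd
  obtain ⟨b, hb, hnd, hsymm⟩ := hσ.exists_symm_form hsd
  have D : NormalFormData ι σ b := ⟨hinj, hn, hσ, hA U σ hU hσ, hb, hnd, hsymm⟩
  refine ⟨⟨⟨IndSpace ι σ b, indRep ι σ b⟩, inferInstance, D.isIrred_indRep,
    D.isSelfDual_indRep, ?_⟩, fun M₁ M₂ h₁ h₂ => ?_, fun S _ _ τ hS hτ => ?_⟩
  · rw [D.repMult_indRep]
    exact odd_one
  · obtain ⟨_, hi₁, hs₁, ho₁⟩ := h₁
    obtain ⟨_, hi₂, hs₂, ho₂⟩ := h₂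
    exact (D.repIso_indRep_of_odd hi₁ hs₁ ho₁).trans (D.repIso_indRep_of_odd hi₂ hs₂ ho₂).symm
  · exact hσ.repMult_comm_of_isSemisimpleRep (hτ.isSemisimpleRep_comp ι hn)

lemma HasUniqueOdd.comp_normal [CharP F 2] [PerfectField F] [Finite C] {ι : A →* B}
    (h : HasUniqueOdd F ι) {ι' : B →* C} (hinj : Function.Injective ι')
    (hn : ∀ g a, ∃ a', g * ι' a * g⁻¹ = ι' a') (hB : IsSplitting F B) :
    HasUniqueOdd F (ι'.comp ι) := by
  intro U _ _ σ hU hσ hsd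
  obtain ⟨⟨W, hW, hWi, hWs, hWo⟩, huniq, hcomm⟩ := h U σ hU hσ hsd
  obtain ⟨⟨M, hM⟩, huniq', -⟩ :=
    hasUniqueOdd_of_normal hinj hn hB W.carrier W.rep hW hWi hWs
  have hdual : ∀ (S : Type) [AddCommGroup S] [Module F S] (τ : Representation F B S),
      FiniteDimensional F S → IsIrred τ →
        repMult σ (τ.dual.comp ι) = repMult σ (τ.comp ι) := by
    intro S _ _ τ hS hτ
    rw [dual_comp, repMult_dual_right, ← repMult_congr_right _ hsd, hcomm S τ hS hτ]
  have hiff : ∀ {V : Type} [AddCommGroup V] [Module F V] (ρ : Representation F C V),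
      IsOddOver (ι'.comp ι) σ ρ ↔ IsOddOver ι' W.rep ρ := by
    intro V _ _ ρ
    refine and_congr_right fun hV => and_congr_right fun hρ => and_congr_right fun hρs => ?_
    have hss := hρ.isSemisimpleRep_comp ι' hn
    have hρs' : IsSelfDual (ρ.comp ι') := by
      have := hρs.comp ι'
      rwa [dual_comp] at this
    have hev := even_repMult_add_repMult ι σ hB W.rep hWi hWs hWo
      (fun S _ _ τ hS hτ hτs ho => huniq ⟨S, τ⟩ W ⟨hS, hτ, hτs, ho⟩ ⟨hW, hWi, hWs, hWo⟩)
      hdual (ρ.comp ι') hss (fun S _ _ τ hS hτ => hss.repMult_dual hτ hρs')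
    rw [Nat.even_add, ← Nat.not_odd_iff_even, ← Nat.not_odd_iff_even] at hev
    exact not_iff_not.1 hev
  refine ⟨⟨M, (hiff _).2 hM⟩, fun M₁ M₂ h₁ h₂ => huniq' M₁ M₂ ((hiff _).1 h₁) ((hiff _).1 h₂),
    fun S _ _ τ hS hτ => ?_⟩
  exact repMult_comm_of_isSemisimpleRep ι σ hcomm (τ.comp ι') (hτ.isSemisimpleRep_comp ι' hn)

lemma hasUniqueOdd_inclusion [CharP F 2] [PerfectField F] [Finite A] (c : ℕ → Subgroup A)
    (hsplit : ∀ K : Subgroup A, IsSplitting F K) (n : ℕ)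
    (hc : ∀ i < n, c i ≤ c (i + 1) ∧ ∀ x ∈ c (i + 1), ∀ a ∈ c i, x * a * x⁻¹ ∈ c i) :
    ∃ h : c 0 ≤ c n, HasUniqueOdd F (Subgroup.inclusion h) := by
  induction n with
  | zero =>
    refine ⟨le_rfl, hasUniqueOdd_of_normal (Subgroup.inclusion_injective _)
      (fun g a => ⟨g * a * g⁻¹, ?_⟩) (hsplit _)⟩
    rfl
  | succ n ih =>
    obtain ⟨h, hT⟩ := ih fun i hi => hc i (hi.trans n.lt_succ_self)
    obtain ⟨hle, hn⟩ := hc n n.lt_succ_self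
    have hcomp : HasUniqueOdd F ((Subgroup.inclusion hle).comp (Subgroup.inclusion h)) :=
      hT.comp_normal (Subgroup.inclusion_injective hle)
        (fun g a => ⟨⟨_, hn g g.2 a a.2⟩, rfl⟩) (hsplit _)
    exact ⟨h.trans hle, hcomp⟩

lemma hasUniqueOdd_subtype [CharP F 2] [PerfectField F] [Finite A] {H : Subgroup A}
    (hH : IsSubnormalIn H) (hsplit : ∀ K : Subgroup A, IsSplitting F K) :
    HasUniqueOdd F H.subtype := by
  obtain ⟨n, c, rfl, htop, hc⟩ := hH
  obtain ⟨h, hT⟩ := hasUniqueOdd_inclusion c hsplit n hc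
  have hcomp : HasUniqueOdd F ((c n).subtype.comp (Subgroup.inclusion h)) :=
    hT.comp_normal (c n).subtype_injective
      (fun g a => ⟨⟨g * a * g⁻¹, htop.ge (Subgroup.mem_top _)⟩, rfl⟩) (hsplit _)
  rwa [Subgroup.subtype_comp_inclusion] at hcomp

end Chain

/-- for H subnormal in G and U a self-dual irreducible FH-module, there is
exactly one self-dual irreducible FG-module V (up to isomorphism) in whose restriction to H
the module U occurs with odd multiplicity. -/
theorem stmt_12 {F : Type} [Field F] [CharP F 2] [PerfectField F]
    {G : Type} [Group G] [Finite G] (H : Subgroup G) (hH : IsSubnormalIn H)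
    (hsplit : ∀ K : Subgroup G, IsSplitting F ↥K)
    {U : Type} [AddCommGroup U] [Module F U] [FiniteDimensional F U]
    (σ : Representation F ↥H U) (hirr : IsIrred σ) (hsd : IsSelfDual σ) :
    (∃ M : RepOn F G, FiniteDimensional F M.carrier ∧ IsIrred M.rep ∧ IsSelfDual M.rep ∧
        Odd (repMult σ (M.rep.comp H.subtype))) ∧
    (∀ M₁ M₂ : RepOn F G,
      (FiniteDimensional F M₁.carrier ∧ IsIrred M₁.rep ∧ IsSelfDual M₁.rep ∧
        Odd (repMult σ (M₁.rep.comp H.subtype))) →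
      (FiniteDimensional F M₂.carrier ∧ IsIrred M₂.rep ∧ IsSelfDual M₂.rep ∧
        Odd (repMult σ (M₂.rep.comp H.subtype))) →
      RepIso M₁.rep M₂.rep) := by
  have h := hasUniqueOdd_subtype hH hsplit U σ inferInstance hirr hsd
  exact ⟨h.1, h.2.1⟩
end

section
/- Let G be a finite group, N a normal subgroup, F a perfect splitting field of characteristic 2, W a nontrivial G-invariant self-dual irreducible FN-module, and let V be the unique self-dual irreducible FG-module in which W occurs with odd multiplicity. Then V admits a non-degenerate G-invariant quadratic form if and only if W admits a non-degenerate N-invariant quadratic form. -/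
open Module

/-- A symmetric matrix of odd size with zero diagonal is singular in characteristic two. -/
lemma Matrix.det_eq_zero_of_odd_card_of_diag_eq_zero {R ι : Type*} [CommRing R] [CharP R 2]
    [Fintype ι] [DecidableEq ι] (hι : Odd (Fintype.card ι)) (A : Matrix ι ι R)
    (hsymm : ∀ i j, A i j = A j i) (hdiag : ∀ i, A i i = 0) : A.det = 0 := by
  rw [Matrix.det_apply]
  refine Finset.sum_involution (fun s _ => s⁻¹) ?_ ?_ (fun _ _ => Finset.mem_univ _)
    (fun _ _ => inv_inv _)
  · intro s _
    have h : ∏ i, A (s⁻¹ i) i = ∏ i, A (s i) i := by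
      rw [← Equiv.prod_comp s]
      refine Finset.prod_congr rfl fun i _ => ?_
      rw [Equiv.Perm.inv_def, Equiv.symm_apply_apply, hsymm]
    rw [Equiv.Perm.sign_inv, h]
    exact CharTwo.add_self_eq_zero _
  · intro s _ hs hinv
    apply hs
    have hsq : s ^ 2 ^ 1 = 1 := by
      rw [pow_one, pow_two]
      nth_rewrite 1 [← hinv]
      exact inv_mul_cancel s
    obtain ⟨i, hi⟩ := Equiv.Perm.exists_fixed_point_of_prime (p := 2) (n := 1)
      (by rw [← even_iff_two_dvd]; exact Nat.not_even_iff_odd.mpr hι) hsq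
    rw [Finset.prod_eq_zero (Finset.mem_univ i) (by rw [hi, hdiag]), smul_zero]

section Forms

variable {F : Type} [Field F] {V : Type} [AddCommGroup V] [Module F V]

lemma PolarizesTo.symm {Q : V → F} {B : V →ₗ[F] V →ₗ[F] F} (h : PolarizesTo Q B) (v w : V) :
    B v w = B w v := by
  have h1 := h.2 v w
  have h2 := h.2 w v
  rw [add_comm w v] at h2
  linear_combination h2 - h1

lemma PolarizesTo.isAltForm [CharP F 2] {Q : V → F} {B : V →ₗ[F] V →ₗ[F] F}
    (h : PolarizesTo Q B) : IsAltForm B := by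
  intro v
  have h1 := h.2 v v
  have h2 := h.1 2 v
  rw [two_smul, h1] at h2
  linear_combination h2 + Q v * (CharTwo.two_eq_zero : (2 : F) = 0)

lemma PolarizesTo.bilinInvariant {G : Type} [Group G] {ρ : Representation F G V} {Q : V → F}
    {B : V →ₗ[F] V →ₗ[F] F} (h : PolarizesTo Q B) (hQ : QuadInvariant ρ Q) :
    BilinInvariant ρ B := by
  intro g v w
  have h1 := h.2 (ρ g v) (ρ g w)
  rw [← map_add, hQ, hQ, hQ] at h1
  linear_combination h.2 v w - h1

lemma IsAltForm.symm [CharP F 2] {B : V →ₗ[F] V →ₗ[F] F} (h : IsAltForm B) (v w : V) :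
    B v w = B w v := by
  have h1 := h (v + w)
  simp only [map_add, LinearMap.add_apply, h v, h w, zero_add, add_zero] at h1
  rw [add_comm, CharTwo.add_eq_zero] at h1
  exact h1

/-- In characteristic two, a nondegenerate alternating form forces even dimension. -/
lemma IsAltForm.not_odd_finrank [CharP F 2] [FiniteDimensional F V] {B : V →ₗ[F] V →ₗ[F] F}
    (h : IsAltForm B) (hB : Nondeg B) : ¬ Odd (finrank F V) := by
  intro hodd
  let c := finBasis F V
  have hdet := Matrix.det_eq_zero_of_odd_card_of_diag_eq_zero (by simpa using hodd)
    (Matrix.of fun i j => B (c i) (c j)) (fun i j => h.symm _ _) (fun i => h _)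
  obtain ⟨x, hx0, hx⟩ := Matrix.exists_vecMul_eq_zero_iff.mpr hdet
  have hv : ∑ i, x i • c i = 0 := by
    apply hB
    intro w
    have key : B (∑ i, x i • c i) = 0 := by
      refine c.ext fun j => ?_
      have := congrFun hx j
      simpa [Matrix.vecMul, dotProduct, LinearMap.sum_apply] using this
    rw [key, LinearMap.zero_apply]
  apply hx0
  funext i
  exact Fintype.linearIndependent_iff.mp c.linearIndependent x hv i

lemma exists_linearEquiv_of_nondeg [FiniteDimensional F V] {B : V →ₗ[F] V →ₗ[F] F}
    (hB : Nondeg B) : ∃ e : V ≃ₗ[F] Dual F V, ∀ v, e v = B v := by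
  have hinj : Function.Injective B := by
    rw [injective_iff_map_eq_zero]
    intro v hv
    exact hB v fun w => by rw [hv, LinearMap.zero_apply]
  exact ⟨B.linearEquivOfInjective hinj Subspace.dual_finrank_eq.symm, fun _ => rfl⟩

end Forms

section Reps

variable {F : Type} [Field F] {G : Type} [Group G]
variable {V W : Type} [AddCommGroup V] [Module F V] [AddCommGroup W] [Module F W]

lemma IsIrred.nondeg_of_ne_zero {ρ : Representation F G V} (hρ : IsIrred ρ)
    {B : V →ₗ[F] V →ₗ[F] F} (hB : BilinInvariant ρ B) (h0 : B ≠ 0) : Nondeg B := by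
  have hsub : IsSubrep ρ (LinearMap.ker B) := by
    intro g v hv
    rw [LinearMap.mem_ker] at hv ⊢
    ext w
    have := hB g v (ρ g⁻¹ w)
    rwa [Representation.self_inv_apply, hv] at this
  rcases hρ.2 _ hsub with h | h
  · intro v hv
    have : v ∈ LinearMap.ker B := LinearMap.ext hv
    rwa [h, Submodule.mem_bot] at this
  · exact absurd (LinearMap.ker_eq_top.mp h) h0

/-- An invariant Frobenius-semilinear functional on a nontrivial irreducible module vanishes. -/
lemma IsIrred.semilinear_eq_zero [CharP F 2] {ρ : Representation F G V} (hρ : IsIrred ρ)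
    (hnt : ¬ IsTrivialRep ρ) {D : V → F} (hadd : ∀ v w, D (v + w) = D v + D w)
    (hsmul : ∀ (a : F) v, D (a • v) = a ^ 2 * D v) (hinv : ∀ g v, D (ρ g v) = D v) (v : V) :
    D v = 0 := by
  have hz : D 0 = 0 := by simpa using hsmul 0 0
  let U : Submodule F V :=
    { carrier := {v | D v = 0}
      add_mem' := fun {v w} hv hw => by
        rw [Set.mem_ofPred_eq] at hv hw ⊢
        rw [hadd, hv, hw, add_zero]
      zero_mem' := hz
      smul_mem' := fun a v hv => by
        rw [Set.mem_ofPred_eq] at hv ⊢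
        rw [hsmul, hv, mul_zero] }
  have hU : ∀ v, v ∈ U ↔ D v = 0 := fun _ => Iff.rfl
  rcases hρ.2 U (fun g v hv => by rw [hU] at hv ⊢; rw [hinv, hv]) with h | h
  · refine absurd (fun g v => ?_) hnt
    have hmem : ρ g v + (-1 : F) • v ∈ U := by
      rw [hU, hadd, hsmul, hinv]
      linear_combination D v * (CharTwo.two_eq_zero : (2 : F) = 0)
    rw [h, Submodule.mem_bot, neg_one_smul, ← sub_eq_add_neg, sub_eq_zero] at hmem
    exact hmem
  · rw [← hU, h]
    exact Submodule.mem_top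

lemma IsSelfDual.exists_bilinInvariant {ρ : Representation F G V} (h : IsSelfDual ρ) :
    ∃ B : V →ₗ[F] V →ₗ[F] F, BilinInvariant ρ B ∧ Nondeg B := by
  obtain ⟨e, he⟩ := h
  refine ⟨e.toLinearMap, fun g v w => ?_, fun v hv => ?_⟩
  · have : e (ρ g v) (ρ g w) = e v w := by
      rw [he, Representation.dual_apply, Module.Dual.transpose_apply,
        LinearMap.comp_apply, Representation.inv_self_apply]
    exact this
  · exact e.map_eq_zero_iff.mp (LinearMap.ext hv)

/-- Fong's lemma: a nontrivial self-dual irreducible module in characteristic two carries a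
nondegenerate invariant alternating form. -/
lemma IsIrred.exists_isAltForm [CharP F 2] {ρ : Representation F G V} (hρ : IsIrred ρ)
    (hnt : ¬ IsTrivialRep ρ) (hsd : IsSelfDual ρ) :
    ∃ B : V →ₗ[F] V →ₗ[F] F, BilinInvariant ρ B ∧ Nondeg B ∧ IsAltForm B := by
  obtain ⟨B, hinv, hB⟩ := hsd.exists_bilinInvariant
  have hinv' : BilinInvariant ρ (B + B.flip) := fun g v w => by
    simp only [LinearMap.add_apply, LinearMap.flip_apply, hinv g]
  by_cases h0 : B + B.flip = 0
  · have hsymm : ∀ v w, B v w + B w v = 0 := fun v w => by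
      simpa using LinearMap.congr_fun (LinearMap.congr_fun h0 v) w
    refine ⟨B, hinv, hB, hρ.semilinear_eq_zero hnt (D := fun v => B v v) ?_ ?_ ?_⟩
    · intro v w
      simp only [map_add, LinearMap.add_apply]
      linear_combination hsymm v w
    · intro a v
      simp only [map_smul, LinearMap.smul_apply, smul_eq_mul]
      ring
    · exact fun g v => hinv g v v
  · refine ⟨B + B.flip, hinv', hρ.nondeg_of_ne_zero hinv' h0, fun v => ?_⟩
    simp only [LinearMap.add_apply, LinearMap.flip_apply]
    exact CharTwo.add_self_eq_zero _

lemma IsSplitting.exists_smul_eq [FiniteDimensional F W] (hF : IsSplitting F G)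
    {σ : Representation F G W} (hσ : IsIrred σ) {β C : W →ₗ[F] W →ₗ[F] F}
    (hβ : BilinInvariant σ β) (hβ' : Nondeg β) (hC : BilinInvariant σ C) :
    ∃ c : F, ∀ w w', C w w' = c * β w w' := by
  obtain ⟨e, he⟩ := exists_linearEquiv_of_nondeg hβ'
  have hf : ∀ w w', β (e.symm (C w)) w' = C w w' := fun w w' => by
    rw [← he, LinearEquiv.apply_symm_apply]
  obtain ⟨c, hc⟩ := hF W σ inferInstance hσ (e.symm.toLinearMap ∘ₗ C) (by
    intro g w
    apply e.injective
    ext w'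
    obtain ⟨u, rfl⟩ : ∃ u, σ g u = w' := ⟨σ g⁻¹ w', Representation.self_inv_apply σ g w'⟩
    simp only [LinearMap.comp_apply, LinearEquiv.coe_coe, he]
    rw [hf, hC, hβ, hf])
  refine ⟨c, fun w w' => ?_⟩
  have := LinearMap.congr_fun hc w
  simp only [LinearMap.comp_apply, LinearEquiv.coe_coe, LinearMap.smul_apply,
    LinearMap.id_apply] at this
  rw [← hf, this, map_smul, LinearMap.smul_apply, smul_eq_mul]

/-- The `σ`-homogeneous component of `τ`. -/
def isotypic (σ : Representation F G W) (τ : Representation F G V) : Submodule F V :=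
  Submodule.span F {v | ∃ f : EquivHom σ τ, ∃ w, f.1 w = v}

lemma mem_isotypic {σ : Representation F G W} {τ : Representation F G V} (f : EquivHom σ τ)
    (w : W) : f.1 w ∈ isotypic σ τ :=
  Submodule.subset_span ⟨f, w, rfl⟩

/-- On a homogeneous module, an invariant form is the product of an invariant form on the
irreducible constituent and a form on the multiplicity space. -/
lemma exists_multiplicity_form [FiniteDimensional F W] (hF : IsSplitting F G)
    {σ : Representation F G W} (hσ : IsIrred σ) {τ : Representation F G V}
    (hspan : isotypic σ τ = ⊤) {β : W →ₗ[F] W →ₗ[F] F} (hβ : BilinInvariant σ β)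
    (hβ' : Nondeg β) {B : V →ₗ[F] V →ₗ[F] F} (hB : BilinInvariant τ B) (hB' : Nondeg B) :
    ∃ b : EquivHom σ τ →ₗ[F] EquivHom σ τ →ₗ[F] F,
      (∀ f f' w w', B (f.1 w) (f'.1 w') = b f f' * β w w') ∧ Nondeg b := by
  obtain ⟨w₀, w₁, hw⟩ : ∃ w₀ w₁, β w₀ w₁ = 1 := by
    have := hσ.1
    obtain ⟨w₀, hw₀⟩ := exists_ne (0 : W)
    have : ∃ w, β w₀ w ≠ 0 := by
      by_contra! h
      exact hw₀ (hβ' w₀ h)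
    obtain ⟨w, hw⟩ := this
    exact ⟨w₀, (β w₀ w)⁻¹ • w, by rw [map_smul, smul_eq_mul, inv_mul_cancel₀ hw]⟩
  let b : EquivHom σ τ →ₗ[F] EquivHom σ τ →ₗ[F] F :=
    B.compl₁₂ ((LinearMap.applyₗ w₀) ∘ₗ (EquivHom σ τ).subtype)
      ((LinearMap.applyₗ w₁) ∘ₗ (EquivHom σ τ).subtype)
  have hb : ∀ f f' w w', B (f.1 w) (f'.1 w') = b f f' * β w w' := by
    intro f f' w w'
    obtain ⟨c, hc⟩ := hF.exists_smul_eq hσ hβ hβ' (C := B.compl₁₂ f.1 f'.1) (by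
      intro g w w'
      simp only [LinearMap.compl₁₂_apply]
      rw [f.2, f'.2, hB])
    simp only [LinearMap.compl₁₂_apply] at hc
    have hbc : b f f' = c := by
      have := hc w₀ w₁
      rw [hw, mul_one] at this
      exact this
    rw [hc, hbc]
  refine ⟨b, hb, fun f hf => ?_⟩
  ext w
  refine hB' _ fun v => ?_
  have hle : isotypic σ τ ≤ LinearMap.ker (B (f.1 w)) := by
    refine Submodule.span_le.mpr ?_
    rintro _ ⟨f', w', rfl⟩
    rw [SetLike.mem_coe, LinearMap.mem_ker, hb, hf, zero_mul]
  exact hle (hspan ▸ Submodule.mem_top)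

lemma exists_equiv_of_isotypic_eq_top [FiniteDimensional F V] [FiniteDimensional F W]
    {σ : Representation F G W} {τ : Representation F G V}
    (hspan : isotypic σ τ = ⊤) {β : W →ₗ[F] W →ₗ[F] F} (hβ : Nondeg β)
    {B : V →ₗ[F] V →ₗ[F] F} {b : EquivHom σ τ →ₗ[F] EquivHom σ τ →ₗ[F] F}
    (hb : ∀ f f' w w', B (f.1 w) (f'.1 w') = b f f' * β w w') (hb' : Nondeg b) :
    ∃ (n : ℕ) (c : Fin n → EquivHom σ τ) (e : (Fin n → W) ≃ₗ[F] V),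
      ∀ u, e u = ∑ i, (c i).1 (u i) := by
  let c := finBasis F (EquivHom σ τ)
  let Φ : (Fin (finrank F (EquivHom σ τ)) → W) →ₗ[F] V :=
    ∑ i, (c i).1 ∘ₗ LinearMap.proj i
  have hΦ : ∀ u, Φ u = ∑ i, (c i).1 (u i) := fun u => by
    simp [Φ, LinearMap.sum_apply]
  have hinj : Function.Injective Φ := by
    rw [injective_iff_map_eq_zero]
    intro u hu
    rw [hΦ] at hu
    have hz : ∀ w' : W, ∑ i, β (u i) w' • c i = 0 := by
      intro w'
      refine (?_ : ∀ x, (∀ f, b x f = 0) → x = 0) _ fun f => ?_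
      · exact hb'
      have : B (∑ i, (c i).1 (u i)) (f.1 w') = 0 := by rw [hu, map_zero, LinearMap.zero_apply]
      simp only [map_sum, LinearMap.sum_apply, hb] at this
      simpa [LinearMap.sum_apply, mul_comm] using this
    funext i
    exact hβ _ fun w' => Fintype.linearIndependent_iff.mp c.linearIndependent _ (hz w') i
  have hsurj : LinearMap.range Φ = ⊤ := by
    rw [eq_top_iff, ← hspan]
    refine Submodule.span_le.mpr ?_
    rintro _ ⟨f, w, rfl⟩
    refine ⟨fun i => c.repr f i • w, ?_⟩
    have h := LinearMap.congr_fun (congrArg (EquivHom σ τ).subtype (c.sum_repr f)) w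
    simp only [map_sum, map_smul, LinearMap.sum_apply, LinearMap.smul_apply,
      Submodule.subtype_apply] at h
    simpa only [hΦ, map_smul] using h
  exact ⟨_, c, LinearEquiv.ofBijective Φ ⟨hinj, LinearMap.range_eq_top.mp hsurj⟩, hΦ⟩

lemma sum_sum_eq_diag_add_lt {M : Type*} [AddCommMonoid M] {n : ℕ} (x : Fin n → Fin n → M) :
    ∑ i, ∑ j, x i j =
      ∑ i, x i i + ∑ i, ∑ j, if i < j then x i j + x j i else 0 := by
  have h1 : ∀ i j, x i j = (if i = j then x i j else 0) +
      ((if i < j then x i j else 0) + (if j < i then x i j else 0)) := by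
    intro i j
    rcases lt_trichotomy i j with h | h | h
    · simp [h, h.ne, h.not_gt]
    · simp [h]
    · simp [h, h.ne', h.not_gt]
  have h2 : ∑ i, ∑ j, (if j < i then x i j else 0) = ∑ i, ∑ j, if i < j then x j i else 0 :=
    Finset.sum_comm
  calc ∑ i, ∑ j, x i j = ∑ i, ∑ j, ((if i = j then x i j else 0) +
        ((if i < j then x i j else 0) + (if j < i then x i j else 0))) :=
        Finset.sum_congr rfl fun i _ => Finset.sum_congr rfl fun j _ => h1 i j
    _ = _ := by
      simp only [Finset.sum_add_distrib, h2, Finset.sum_ite_eq, Finset.mem_univ, if_true]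
      congr 1
      rw [← Finset.sum_add_distrib]
      refine Finset.sum_congr rfl fun i _ => ?_
      rw [← Finset.sum_add_distrib]
      refine Finset.sum_congr rfl fun j _ => ?_
      split_ifs <;> simp

/-- On a homogeneous module whose constituent is of quadratic type, every nondegenerate invariant
alternating form is the polarization of an invariant quadratic form. -/
lemma exists_quadInvariant_of_isotypic [CharP F 2] [FiniteDimensional F V]
    [FiniteDimensional F W] (hF : IsSplitting F G) {σ : Representation F G W} (hσ : IsIrred σ)
    {τ : Representation F G V} (hspan : isotypic σ τ = ⊤) (hq : HasQuadType σ)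
    {B : V →ₗ[F] V →ₗ[F] F} (hB : BilinInvariant τ B) (hB' : Nondeg B) (halt : IsAltForm B) :
    ∃ Q, PolarizesTo Q B ∧ QuadInvariant τ Q := by
  obtain ⟨q, β, hqβ, hqinv, hβ'⟩ := hq
  have hβ := hqβ.bilinInvariant hqinv
  obtain ⟨b, hb, hb'⟩ := exists_multiplicity_form hF hσ hspan hβ hβ' hB hB'
  obtain ⟨n, c, e, he⟩ := exists_equiv_of_isotypic_eq_top hspan hβ' hb hb'
  have hesymm : ∀ g v i, e.symm (τ g v) i = σ g (e.symm v i) := by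
    intro g v i
    have : e.symm (τ g v) = fun i => σ g (e.symm v i) := by
      rw [LinearEquiv.symm_apply_eq, he]
      simp only [(c _).2 g]
      rw [← map_sum, ← he, LinearEquiv.apply_symm_apply]
    rw [this]
  have hBe : ∀ v w, B v w =
      ∑ i, ∑ j, b (c i) (c j) * β (e.symm v i) (e.symm w j) := by
    intro v w
    conv_lhs => rw [← e.apply_symm_apply v, ← e.apply_symm_apply w, he, he]
    simp only [map_sum, LinearMap.sum_apply, hb]
    exact Finset.sum_comm
  have hbsymm : ∀ i j, b (c i) (c j) = b (c j) (c i) := by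
    intro i j
    have := hσ.1
    obtain ⟨w, hw⟩ := exists_ne (0 : W)
    obtain ⟨w', hw'⟩ : ∃ w', β w w' ≠ 0 := by
      by_contra! h
      exact hw (hβ' w h)
    refine mul_right_cancel₀ hw' ?_
    rw [← hb, halt.symm, hb, hqβ.symm]
  let Q : V → F := fun v =>
    ∑ i, b (c i) (c i) * q (e.symm v i) +
      ∑ i, ∑ j, if i < j then b (c i) (c j) * β (e.symm v i) (e.symm v j) else 0
  refine ⟨Q, ⟨fun a v => ?_, fun v w => ?_⟩, fun g v => ?_⟩
  · simp only [Q, map_smul, Pi.smul_apply, hqβ.1, LinearMap.smul_apply, smul_eq_mul, mul_add,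
      Finset.mul_sum, mul_ite, mul_zero]
    congr 1
    · exact Finset.sum_congr rfl fun i _ => by ring
    · refine Finset.sum_congr rfl fun i _ => Finset.sum_congr rfl fun j _ => ?_
      split_ifs
      · ring
      · rfl
  · rw [hBe, sum_sum_eq_diag_add_lt]
    have h1 : ∑ i, b (c i) (c i) * q (e.symm (v + w) i) =
        ∑ i, b (c i) (c i) * q (e.symm v i) +
        ∑ i, b (c i) (c i) * β (e.symm v i) (e.symm w i) +
        ∑ i, b (c i) (c i) * q (e.symm w i) := by
      simp only [← Finset.sum_add_distrib, map_add, Pi.add_apply, hqβ.2, mul_add]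
    have h2 : (∑ i, ∑ j, if i < j then
          b (c i) (c j) * β (e.symm (v + w) i) (e.symm (v + w) j) else 0) =
        (∑ i, ∑ j, if i < j then b (c i) (c j) * β (e.symm v i) (e.symm v j) else 0) +
        (∑ i, ∑ j, if i < j then b (c i) (c j) * β (e.symm v i) (e.symm w j) +
          b (c j) (c i) * β (e.symm v j) (e.symm w i) else 0) +
        (∑ i, ∑ j, if i < j then b (c i) (c j) * β (e.symm w i) (e.symm w j) else 0) := by
      simp only [← Finset.sum_add_distrib]
      refine Finset.sum_congr rfl fun i _ => Finset.sum_congr rfl fun j _ => ?_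
      split_ifs
      · rw [hbsymm j i, hqβ.symm (e.symm v j)]
        simp only [map_add, Pi.add_apply, LinearMap.add_apply]
        ring
      · simp
    simp only [Q]
    rw [h1, h2]
    ring
  · simp only [Q, hesymm, hqinv g _, hβ g _ _]

/-- Conversely, on a homogeneous module of odd multiplicity, some copy of the constituent
inherits a nondegenerate quadratic form. -/
lemma hasQuadType_of_isotypic [CharP F 2] [FiniteDimensional F V]
    [FiniteDimensional F W] (hF : IsSplitting F G) {σ : Representation F G W} (hσ : IsIrred σ)
    (hsd : IsSelfDual σ) {τ : Representation F G V} (hspan : isotypic σ τ = ⊤)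
    (hodd : Odd (repMult σ τ)) (hq : HasQuadType τ) : HasQuadType σ := by
  obtain ⟨Q, B, hQB, hQ, hB'⟩ := hq
  have hB := hQB.bilinInvariant hQ
  obtain ⟨β, hβ, hβ'⟩ := hsd.exists_bilinInvariant
  obtain ⟨b, hb, hb'⟩ := exists_multiplicity_form hF hσ hspan hβ hβ' hB hB'
  obtain ⟨f, hf⟩ : ∃ f, b f f ≠ 0 := by
    by_contra! h
    exact IsAltForm.not_odd_finrank (B := b) h hb' hodd
  refine ⟨fun w => Q (f.1 w), B.compl₁₂ f.1 f.1, ⟨fun a w => ?_, fun v w => ?_⟩,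
    fun g w => ?_, fun w hw => hβ' w fun w' => ?_⟩
  · simp only [map_smul, hQB.1]
  · simp only [map_add, hQB.2, LinearMap.compl₁₂_apply]
  · simp only [f.2 g w, hQ g _]
  · have := hw w'
    rw [LinearMap.compl₁₂_apply, hb] at this
    exact (mul_eq_zero.mp this).resolve_left hf

/-- Clifford: an irreducible module lying over an invariant irreducible module restricts to a
homogeneous module. -/
lemma IsIrred.isotypic_restrict_eq_top {N : Subgroup G} [N.Normal] {σ : Representation F ↥N W}
    (hGinv : ∀ g : G, RepIso σ (σ.comp (MulAut.conjNormal g).toMonoidHom))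
    {ρ : Representation F G V} (hρ : IsIrred ρ) (hne : EquivHom σ (ρ.comp N.subtype) ≠ ⊥) :
    isotypic σ (ρ.comp N.subtype) = ⊤ := by
  have hsub : IsSubrep ρ (isotypic σ (ρ.comp N.subtype)) := by
    intro g
    suffices isotypic σ (ρ.comp N.subtype) ≤
        (isotypic σ (ρ.comp N.subtype)).comap (ρ g) from fun v hv => this hv
    refine Submodule.span_le.mpr ?_
    rintro _ ⟨f, w, rfl⟩
    obtain ⟨e, he⟩ := hGinv g⁻¹
    have hmem : ρ g ∘ₗ f.1 ∘ₗ e.toLinearMap ∈ EquivHom σ (ρ.comp N.subtype) := by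
      intro n w
      have hn : g * ((MulAut.conjNormal g⁻¹ n : N) : G) = n * g := by
        rw [MulAut.conjNormal_apply]
        group
      have h1 : e (σ n w) = σ (MulAut.conjNormal g⁻¹ n) (e w) := he n w
      have h2 : ∀ u, f.1 (σ (MulAut.conjNormal g⁻¹ n) u) =
          ρ ((MulAut.conjNormal g⁻¹ n : N) : G) (f.1 u) := fun u => f.2 _ u
      change ρ g (f.1 (e (σ n w))) = ρ (n : G) (ρ g (f.1 (e w)))
      rw [h1, h2, ← Module.End.mul_apply, ← Module.End.mul_apply, ← map_mul, ← map_mul, hn]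
    have := mem_isotypic ⟨_, hmem⟩ (e.symm w)
    simpa using this
  refine (hρ.2 _ hsub).resolve_left fun h => hne ?_
  rw [Submodule.eq_bot_iff]
  intro f hf
  ext w
  have := mem_isotypic ⟨f, hf⟩ w
  rwa [h, Submodule.mem_bot] at this

/-- An `N`-invariant quadratic form is determined by its polarization when the restriction to
`N` is homogeneous over a nontrivial irreducible module. -/
lemma PolarizesTo.eq_of_isotypic [CharP F 2] {σ : Representation F G W} (hσ : IsIrred σ)
    (hnt : ¬ IsTrivialRep σ) {τ : Representation F G V} (hspan : isotypic σ τ = ⊤)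
    {Q Q' : V → F} {B : V →ₗ[F] V →ₗ[F] F} (hQ : PolarizesTo Q B) (hQ' : PolarizesTo Q' B)
    (hinv : QuadInvariant τ Q) (hinv' : QuadInvariant τ Q') (v : V) : Q v = Q' v := by
  have hv : v ∈ isotypic σ τ := hspan ▸ Submodule.mem_top
  have hzero : ∀ {Q}, PolarizesTo Q B → Q 0 = 0 := fun h => by simpa using h.1 0 0
  induction hv using Submodule.span_induction with
  | mem _ h =>
    obtain ⟨f, w, rfl⟩ := h
    rw [← sub_eq_zero]
    refine hσ.semilinear_eq_zero hnt (D := fun w => Q (f.1 w) - Q' (f.1 w)) ?_ ?_ ?_ w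
    · intro v w
      simp only [map_add, hQ.2, hQ'.2]
      ring
    · intro a w
      simp only [map_smul, hQ.1, hQ'.1]
      ring
    · intro g w
      simp only [f.2 g w, hinv g _, hinv' g _]
  | zero => rw [hzero hQ, hzero hQ']
  | add v w _ _ h1 h2 => rw [hQ.2, hQ'.2, h1, h2]
  | smul a v _ h => rw [hQ.1, hQ'.1, h]

end Reps

/-- W nontrivial G-invariant self-dual irreducible FN-module, V the (unique)
self-dual irreducible FG-module in which W occurs with odd multiplicity.  Then V has a
non-degenerate G-invariant quadratic form iff W has a non-degenerate N-invariant one. -/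
theorem stmt_13 {F : Type} [Field F] [CharP F 2] [PerfectField F]
    {G : Type} [Group G] [Finite G] (N : Subgroup G) [N.Normal]
    (hsplit : ∀ H : Subgroup G, IsSplitting F ↥H)
    {W : Type} [AddCommGroup W] [Module F W] [FiniteDimensional F W]
    (σ : Representation F ↥N W) (hirrW : IsIrred σ) (hsdW : IsSelfDual σ)
    (hntW : ¬ IsTrivialRep σ)
    (hGinv : ∀ g : G, RepIso σ (σ.comp (MulAut.conjNormal g).toMonoidHom))
    {V : Type} [AddCommGroup V] [Module F V] [FiniteDimensional F V]
    (ρ : Representation F G V) (hirrV : IsIrred ρ) (hsdV : IsSelfDual ρ)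
    (hodd : Odd (repMult σ (ρ.comp N.subtype))) :
    HasQuadType ρ ↔ HasQuadType σ := by
  have hne : EquivHom σ (ρ.comp N.subtype) ≠ ⊥ := by
    intro h
    rw [repMult, h, finrank_bot] at hodd
    exact Nat.not_odd_zero hodd
  have hspan := hirrV.isotypic_restrict_eq_top hGinv hne
  constructor
  · rintro ⟨Q, B, hQB, hQ, hB⟩
    exact hasQuadType_of_isotypic (hsplit N) hirrW hsdW hspan hodd
      ⟨Q, B, hQB, fun n v => hQ n v, hB⟩
  · intro hq
    have hntV : ¬ IsTrivialRep ρ := by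
      intro htriv
      obtain ⟨f, hf, hf0⟩ := Submodule.exists_mem_ne_zero_of_ne_bot hne
      have hker : IsSubrep σ (LinearMap.ker f) := by
        intro n w hw
        rw [LinearMap.mem_ker] at hw ⊢
        rw [hf, hw, map_zero]
      have hinj : Function.Injective f := LinearMap.ker_eq_bot.mp <|
        (hirrW.2 _ hker).resolve_right fun h => hf0 (LinearMap.ker_eq_top.mp h)
      exact hntW fun n w => hinj ((hf n w).trans (htriv n (f w)))
    obtain ⟨B, hB, hB', halt⟩ := hirrV.exists_isAltForm hntV hsdV
    obtain ⟨Q, hQB, hQ⟩ := exists_quadInvariant_of_isotypic (hsplit N) hirrW hspan hq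
      (fun n v w => hB n v w) hB' halt
    refine ⟨Q, B, hQB, fun g v => ?_, hB'⟩
    refine PolarizesTo.eq_of_isotypic (Q := fun v => Q (ρ g v)) hirrW hntW hspan
      ⟨fun a v => ?_, fun v w => ?_⟩ hQB (fun n v => ?_) hQ v
    · simp only [map_smul, hQB.1]
    · simp only [map_add, hQB.2, hB g v w]
    · have h : ρ g (ρ n v) = ρ ((MulAut.conjNormal g n : N) : G) (ρ g v) := by
        rw [MulAut.conjNormal_apply, ← Module.End.mul_apply, ← Module.End.mul_apply, ← map_mul,
          ← map_mul]
        congr 2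
        group
      change Q (ρ g (ρ n v)) = Q (ρ g v)
      rw [h]
      exact hQ (MulAut.conjNormal g n) (ρ g v)
end
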